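/- arXiv:1304.0739 — 6 statements merged into one kernel-verified Lean document; each statement's English description precedes it below -/
import Mathlib

section
/- Let (E; ⊕, 0) be a generalized effect algebra that is upwards directed. Then E is monotone Dedekind upwards σ-complete if and only if E is monotone Dedekind downwards σ-complete. -/
set_option autoImplicit false

/-- A generalized effect algebra: a set with a distinguished element `zero` and a partially
defined binary operation (encoded as an `Option`-valued total operation, `op a b = some c`
meaning "`a ⊕ b` is defined and equals `c`", `op a b = none` meaning "`a ⊕ b` is undefined")
satisfying commutativity, associativity, the zero law, cancellation, and positivity;
each law is understood so that if one side is defined then so is the other. -/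
structure GEA (E : Type*) where
  op : E → E → Option E
  zero : E
  comm : ∀ a b : E, op a b = op b a
  assoc : ∀ a b c : E,
    (op a b).bind (fun x => op x c) = (op b c).bind (fun y => op a y)
  op_zero : ∀ a : E, op a zero = some a
  cancel : ∀ a b c d : E, op a b = some d → op a c = some d → b = c
  pos_law : ∀ a b : E, op a b = some zero → a = zero ∧ b = zero

namespace GEA

variable {E : Type*} (G : GEA E)

/-- The induced partial order: `a ≤ b` iff `a ⊕ c = b` for some `c`. -/
def le (a b : E) : Prop := ∃ c : E, G.op a c = some b

/-- `x` is the supremum of `S` with respect to the induced partial order. -/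
def IsSup (S : Set E) (x : E) : Prop :=
  (∀ y ∈ S, G.le y x) ∧ ∀ z : E, (∀ y ∈ S, G.le y z) → G.le x z

/-- `x` is the infimum of `S` with respect to the induced partial order. -/
def IsInf (S : Set E) (x : E) : Prop :=
  (∀ y ∈ S, G.le x y) ∧ ∀ z : E, (∀ y ∈ S, G.le z y) → G.le z x

/-- `G` is monotone Dedekind upwards σ-complete: every non-decreasing sequence dominated
by some element has a supremum. -/
def UpSigmaComplete : Prop :=
  ∀ f : ℕ → E, (∀ n, G.le (f n) (f (n + 1))) → (∃ b : E, ∀ n, G.le (f n) b) →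
    ∃ s : E, G.IsSup (Set.range f) s

/-- `G` is monotone Dedekind downwards σ-complete: every non-increasing sequence has an
infimum. -/
def DownSigmaComplete : Prop :=
  ∀ f : ℕ → E, (∀ n, G.le (f (n + 1)) (f n)) → ∃ i : E, G.IsInf (Set.range f) i

/-- `G` is upwards directed: any two elements have a common upper bound. -/
def UpDirected : Prop := ∀ a b : E, ∃ c : E, G.le a c ∧ G.le b c

end GEA

namespace GEA

variable {E : Type*} {G : GEA E}

lemma exists_op_of_op_op {a b c x d : E} (hx : G.op a b = some x) (hd : G.op x c = some d) :
    ∃ y, G.op b c = some y ∧ G.op a y = some d := by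
  have h := G.assoc a b c
  rw [hx, Option.bind_some, hd] at h
  exact Option.bind_eq_some_iff.mp h.symm

lemma le_of_op_left {a b c : E} (h : G.op a b = some c) : G.le a c := ⟨b, h⟩

lemma le_of_op_right {a b c : E} (h : G.op a b = some c) : G.le b c := ⟨a, G.comm b a ▸ h⟩

lemma le_trans {a b c : E} (hab : G.le a b) (hbc : G.le b c) : G.le a c := by
  obtain ⟨x, hx⟩ := hab
  obtain ⟨y, hy⟩ := hbc
  obtain ⟨z, -, hz⟩ := exists_op_of_op_op hx hy
  exact ⟨z, hz⟩

lemma le_refl (a : E) : G.le a a := ⟨G.zero, G.op_zero a⟩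

/-- Taking complements below a fixed element reverses the order. -/
lemma compl_le_compl {a a' c c' b : E} (ha : G.op a a' = some b) (hc : G.op c c' = some b)
    (h : G.le a c) : G.le c' a' := by
  obtain ⟨x, hx⟩ := h
  obtain ⟨y, hy, hay⟩ := exists_op_of_op_op hx hc
  obtain rfl := G.cancel _ _ _ _ ha hay
  exact le_of_op_right hy

lemma compl_le_compl' {a a' c c' b : E} (ha : G.op a a' = some b) (hc : G.op c c' = some b)
    (h : G.le c' a') : G.le a c :=
  compl_le_compl (G.comm c c' ▸ hc) (G.comm a a' ▸ ha) h

lemma le_zero_of_antitone {f : ℕ → E} (hf : ∀ n, G.le (f (n + 1)) (f n)) (n : ℕ) :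
    G.le (f n) (f 0) := by
  induction n with
  | zero => exact le_refl _
  | succ n ih => exact le_trans (hf n) ih

lemma UpSigmaComplete.downSigmaComplete (h : G.UpSigmaComplete) : G.DownSigmaComplete := by
  intro f hf
  choose g hg using le_zero_of_antitone hf
  obtain ⟨s, hs, hmin⟩ := h g (fun n => compl_le_compl (hg (n + 1)) (hg n) (hf n))
    ⟨f 0, fun n => le_of_op_right (hg n)⟩
  simp only [Set.forall_mem_range] at hs hmin
  obtain ⟨i, hi⟩ := hmin (f 0) fun n => le_of_op_right (hg n)
  refine ⟨i, Set.forall_mem_range.mpr fun n => ?_, fun z hz => ?_⟩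
  · exact compl_le_compl (G.comm (f n) (g n) ▸ hg n) hi (hs n)
  · rw [Set.forall_mem_range] at hz
    obtain ⟨z', hz'⟩ := hz 0
    exact compl_le_compl' hz' (G.comm s i ▸ hi) (hmin z' fun n => compl_le_compl hz' (hg n) (hz n))

/-- A monotone sequence below `b` has a supremum relative to the interval below `b`. -/
lemma DownSigmaComplete.exists_sup_below (h : G.DownSigmaComplete) {f : ℕ → E} {b : E}
    (hf : ∀ n, G.le (f n) (f (n + 1))) (hb : ∀ n, G.le (f n) b) :
    ∃ s, G.le s b ∧ (∀ n, G.le (f n) s) ∧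
      ∀ z, G.le z b → (∀ n, G.le (f n) z) → G.le s z := by
  choose g hg using hb
  obtain ⟨i, hi, hmax⟩ := h g fun n => compl_le_compl (hg n) (hg (n + 1)) (hf n)
  simp only [Set.forall_mem_range] at hi hmax
  obtain ⟨s, hs⟩ := le_trans (hi 0) (le_of_op_right (hg 0))
  rw [G.comm] at hs
  refine ⟨s, le_of_op_left hs, fun n => compl_le_compl' (hg n) hs (hi n), ?_⟩
  rintro z ⟨z', hz'⟩ hz
  exact compl_le_compl' hs hz' (hmax z' fun n => compl_le_compl (hg n) hz' (hz n))

lemma DownSigmaComplete.upSigmaComplete (h : G.DownSigmaComplete) (hdir : G.UpDirected) :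
    G.UpSigmaComplete := by
  rintro f hf ⟨b, hb⟩
  obtain ⟨s, hsb, hs, hmin⟩ := h.exists_sup_below hf hb
  refine ⟨s, Set.forall_mem_range.mpr hs, fun z hz => ?_⟩
  rw [Set.forall_mem_range] at hz
  obtain ⟨c, hbc, hzc⟩ := hdir b z
  obtain ⟨t, -, ht, htmin⟩ := h.exists_sup_below hf fun n => le_trans (hb n) hbc
  have hts : G.le t s := htmin s (le_trans hsb hbc) hs
  exact le_trans (hmin t (le_trans hts hsb) ht) (htmin z hzc hz)

end GEA

/-- An upwards directed generalized effect algebra is monotone Dedekind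
upwards σ-complete iff it is monotone Dedekind downwards σ-complete. -/
theorem stmt_13 {E : Type*} (G : GEA E) (hdir : G.UpDirected) :
    G.UpSigmaComplete ↔ G.DownSigmaComplete := by
  exact ⟨fun h => h.downSigmaComplete, fun h => h.upSigmaComplete hdir⟩
end

section
/- Let 𝓗 be an infinite-dimensional complex Hilbert space. Then the generalized effect algebra (𝓥_f(𝓗); ⊕, o) is monotone Dedekind downwards σ-complete: every sequence t₁ ≥ t₂ ≥ ⋯ in 𝓥_f(𝓗) (with respect to the order induced by ⊕) has an infimum t in 𝓥_f(𝓗), and t satisfies t(u,v) = lim_{n→∞} t_n(u,v) for all u, v in the common eventual domain of the t_n. -/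
set_option autoImplicit false

noncomputable section

open Filter

variable {H : Type*}

/-- A densely defined positive bilinear (sesquilinear) form on a complex Hilbert space `H`:
it is given by a dense domain `dom` and a map `toFun : H → H → ℂ` which is linear in the
first argument and conjugate-linear in the second one on the domain, takes real nonnegative
values on the diagonal of the domain, and (as a normalization) vanishes off the domain. -/
structure PBF (H : Type*) [NormedAddCommGroup H] [InnerProductSpace ℂ H] where
  dom : Submodule ℂ H
  dense' : Dense (dom : Set H)
  toFun : H → H → ℂ
  zero_off : ∀ x y : H, x ∉ dom ∨ y ∉ dom → toFun x y = 0
  add_left : ∀ x y z : H, x ∈ dom → y ∈ dom → z ∈ dom →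
    toFun (x + y) z = toFun x z + toFun y z
  smul_left : ∀ (c : ℂ) (x y : H), x ∈ dom → y ∈ dom →
    toFun (c • x) y = c * toFun x y
  add_right : ∀ x y z : H, x ∈ dom → y ∈ dom → z ∈ dom →
    toFun x (y + z) = toFun x y + toFun x z
  smul_right : ∀ (c : ℂ) (x y : H), x ∈ dom → y ∈ dom →
    toFun x (c • y) = (starRingEnd ℂ) c * toFun x y
  re_nonneg : ∀ x : H, x ∈ dom → 0 ≤ (toFun x x).re
  im_zero : ∀ x : H, x ∈ dom → (toFun x x).im = 0

variable [NormedAddCommGroup H] [InnerProductSpace ℂ H]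

namespace PBF

/-- A positive bilinear form is bounded if `sup {t(x,x) : x ∈ D(t), ‖x‖ = 1} < ∞`. -/
def Bounded (t : PBF H) : Prop :=
  ∃ c : ℝ, ∀ x ∈ t.dom, (t.toFun x x).re ≤ c * ‖x‖ ^ 2

/-- Membership in `𝓥_f(𝓗)`: a positive bilinear form whose domain is all of `H`
whenever the form is bounded. -/
def InVf (t : PBF H) : Prop := t.Bounded → t.dom = ⊤

/-- `u` is the usual sum `t + s`, with domain `D(t) ⊓ D(s)`. -/
def IsSum (t s u : PBF H) : Prop :=
  u.dom = t.dom ⊓ s.dom ∧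
  ∀ x y : H, x ∈ u.dom → y ∈ u.dom → u.toFun x y = t.toFun x y + s.toFun x y

/-- Definedness of the partial operation `⊕` on `𝓥_f(𝓗)`:
`t ⊕ s` is defined iff `t` or `s` is bounded, or `D(t) = D(s)`. -/
def OplusDef (t s : PBF H) : Prop := t.Bounded ∨ s.Bounded ∨ t.dom = s.dom

/-- `t ⊕ s = u` in `𝓥_f(𝓗)`. -/
def Oplus (t s u : PBF H) : Prop := OplusDef t s ∧ IsSum t s u

/-- The squared norm `‖x‖_t² = t(x,x) + ‖x‖²` associated with the inner product
`(x,y)_t := t(x,y) + (x,y)` on `D(t)`. -/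
def q (t : PBF H) (x : H) : ℝ := (t.toFun x x).re + ‖x‖ ^ 2

/-- `t` is closed: `D(t)` is complete under the inner product `(x,y)_t := t(x,y) + (x,y)`
(sequential formulation of completeness). -/
def IsClosedForm (t : PBF H) : Prop :=
  ∀ f : ℕ → H, (∀ n, f n ∈ t.dom) →
    (∀ ε : ℝ, 0 < ε → ∃ N : ℕ, ∀ m ≥ N, ∀ n ≥ N, t.q (f m - f n) < ε) →
    ∃ x ∈ t.dom, Tendsto (fun n => t.q (f n - x)) atTop (nhds 0)

/-- `s` is an extension of `t` (i.e. `s|_{D(t)} = t`). -/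
def Extends (s t : PBF H) : Prop :=
  t.dom ≤ s.dom ∧ ∀ x y : H, x ∈ t.dom → y ∈ t.dom → s.toFun x y = t.toFun x y

/-- `t` is closable (equivalently, regular) iff it has a closed extension. -/
def Closable (t : PBF H) : Prop := ∃ s : PBF H, s.IsClosedForm ∧ s.Extends t

/-- `t` is singular: the only closable positive bilinear form `r` with `D(r) = D(t)` and
`r(x,x) ≤ t(x,x)` on `D(t)` is the zero form. -/
def Singular (t : PBF H) : Prop :=
  ∀ r : PBF H, r.Closable → r.dom = t.dom →
    (∀ x ∈ t.dom, (r.toFun x x).re ≤ (t.toFun x x).re) →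
    ∀ x y : H, r.toFun x y = 0

/-- `tr` is the regular part of `t`: the largest closable positive bilinear form `r` with
`D(r) = D(t)` and `r(x,x) ≤ t(x,x)` for all `x ∈ D(t)` (Simon's decomposition theorem). -/
def IsRegularPart (t tr : PBF H) : Prop :=
  tr.Closable ∧ tr.dom = t.dom ∧
  (∀ x ∈ t.dom, (tr.toFun x x).re ≤ (t.toFun x x).re) ∧
  ∀ r : PBF H, r.Closable → r.dom = t.dom →
    (∀ x ∈ t.dom, (r.toFun x x).re ≤ (t.toFun x x).re) →
    ∀ x ∈ t.dom, (r.toFun x x).re ≤ (tr.toFun x x).re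

end PBF

/-- The zero form `o`, with `D(o) = 𝓗`. -/
def zeroPBF (H : Type*) [NormedAddCommGroup H] [InnerProductSpace ℂ H] : PBF H where
  dom := ⊤
  dense' := by rw [Submodule.top_coe]; exact dense_univ
  toFun := fun _ _ => 0
  zero_off := fun _ _ _ => rfl
  add_left := by intros; simp
  smul_left := by intros; simp
  add_right := by intros; simp
  smul_right := by intros; simp
  re_nonneg := by intros; simp
  im_zero := by intros; simp

/-- `Q` is (the carrier of) a sub-generalized effect algebra of `(𝓥_f(𝓗); ⊕, o)`:
it contains `o`, and whenever `x ⊕ y = z` in `𝓥_f(𝓗)` with at least two of `x, y, z`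
in `Q`, then all three are in `Q`. -/
def SubGEACond (Q : PBF H → Prop) : Prop :=
  Q (zeroPBF H) ∧
  ∀ x y z : PBF H, x.InVf → y.InVf → z.InVf → PBF.Oplus x y z →
    ((Q x ∧ Q y) ∨ (Q x ∧ Q z) ∨ (Q y ∧ Q z)) → (Q x ∧ Q y ∧ Q z)

/-- Membership in the generalized effect algebra carried by `{t ∈ 𝓥_f(𝓗) : Q t}`. -/
def MemAlg (Q : PBF H → Prop) (t : PBF H) : Prop := t.InVf ∧ Q t

/-- The order induced by the restricted operation `⊕|_Q` on `{t ∈ 𝓥_f(𝓗) : Q t}`: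
`s ≤ t` iff `s ⊕ r = t` for some `r` in the algebra. -/
def leQ (Q : PBF H → Prop) (s t : PBF H) : Prop :=
  ∃ r : PBF H, MemAlg Q r ∧ PBF.Oplus s r t

/-- The order induced by `⊕` on `𝓥_f(𝓗)`: `s ≤ t` iff `s ⊕ r = t` for some `r ∈ 𝓥_f(𝓗)`. -/
def leVf (s t : PBF H) : Prop := ∃ r : PBF H, r.InVf ∧ PBF.Oplus s r t

/-- The algebra `{t ∈ 𝓥_f(𝓗) : Q t}` is monotone Dedekind upwards σ-complete: every
non-decreasing sequence dominated by some element has a supremum (w.r.t. the induced order). -/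
def UpSigmaQ (Q : PBF H → Prop) : Prop :=
  ∀ f : ℕ → PBF H, (∀ n, MemAlg Q (f n)) → (∀ n, leQ Q (f n) (f (n + 1))) →
    (∃ b : PBF H, MemAlg Q b ∧ ∀ n, leQ Q (f n) b) →
    ∃ s : PBF H, MemAlg Q s ∧ (∀ n, leQ Q (f n) s) ∧
      ∀ z : PBF H, MemAlg Q z → (∀ n, leQ Q (f n) z) → leQ Q s z

/-- The algebra `{t ∈ 𝓥_f(𝓗) : Q t}` is monotone Dedekind downwards σ-complete: every
non-increasing sequence has an infimum (w.r.t. the induced order). -/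
def DownSigmaQ (Q : PBF H → Prop) : Prop :=
  ∀ f : ℕ → PBF H, (∀ n, MemAlg Q (f n)) → (∀ n, leQ Q (f (n + 1)) (f n)) →
    ∃ i : PBF H, MemAlg Q i ∧ (∀ n, leQ Q i (f n)) ∧
      ∀ z : PBF H, MemAlg Q z → (∀ n, leQ Q z (f n)) → leQ Q z i

namespace PBF

open Topology ComplexConjugate

/-- The positive form on the dense domain `D` obtained by cutting off a map which has the
algebraic properties of a positive form on `D`. -/
def ofMapOn (D : Submodule ℂ H) (hD : Dense (D : Set H)) (g : H → H → ℂ)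
    (add_left : ∀ x ∈ D, ∀ y ∈ D, ∀ z ∈ D, g (x + y) z = g x z + g y z)
    (smul_left : ∀ (c : ℂ), ∀ x ∈ D, ∀ y ∈ D, g (c • x) y = c * g x y)
    (add_right : ∀ x ∈ D, ∀ y ∈ D, ∀ z ∈ D, g x (y + z) = g x y + g x z)
    (smul_right : ∀ (c : ℂ), ∀ x ∈ D, ∀ y ∈ D, g x (c • y) = conj c * g x y)
    (nonneg : ∀ x ∈ D, 0 ≤ (g x x).re) (im_zero : ∀ x ∈ D, (g x x).im = 0) : PBF H where
  dom := D
  dense' := hD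
  toFun x y := by
    classical exact if x ∈ D ∧ y ∈ D then g x y else 0
  zero_off x y h := by
    rw [if_neg]
    tauto
  add_left x y z hx hy hz := by
    simp [hx, hy, hz, D.add_mem hx hy, add_left x hx y hy z hz]
  smul_left c x y hx hy := by
    simp [hx, hy, D.smul_mem c hx, smul_left c x hx y hy]
  add_right x y z hx hy hz := by
    simp [hx, hy, hz, D.add_mem hy hz, add_right x hx y hy z hz]
  smul_right c x y hx hy := by
    simp [hx, hy, D.smul_mem c hy, smul_right c x hx y hy]
  re_nonneg x hx := by simp [hx, nonneg x hx]
  im_zero x hx := by simp [hx, im_zero x hx]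

theorem conj_apply (t : PBF H) {x y : H} (hx : x ∈ t.dom) (hy : y ∈ t.dom) :
    conj (t.toFun x y) = t.toFun y x := by
  have hIy := t.dom.smul_mem Complex.I hy
  have h1 := t.im_zero (x + y) (t.dom.add_mem hx hy)
  have h2 := t.im_zero (x + Complex.I • y) (t.dom.add_mem hx hIy)
  rw [t.add_left _ _ _ hx hy (t.dom.add_mem hx hy), t.add_right _ _ _ hx hx hy,
    t.add_right _ _ _ hy hx hy] at h1
  rw [t.add_left _ _ _ hx hIy (t.dom.add_mem hx hIy), t.add_right _ _ _ hx hx hIy,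
    t.add_right _ _ _ hIy hx hIy, t.smul_right _ _ _ hx hy, t.smul_left _ _ _ hy hx] at h2
  have hxx := t.im_zero x hx
  have hyy := t.im_zero y hy
  have hII := t.im_zero _ hIy
  simp only [Complex.add_im, Complex.mul_im, Complex.conj_I, Complex.neg_re, Complex.neg_im,
    Complex.I_re, Complex.I_im] at h1 h2
  apply Complex.ext
  · rw [Complex.conj_re]; linarith
  · rw [Complex.conj_im]; linarith

theorem re_add_apply (t : PBF H) {x y : H} (hx : x ∈ t.dom) (hy : y ∈ t.dom) :
    (t.toFun (x + y) (x + y)).re =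
      (t.toFun x x).re + 2 * (t.toFun x y).re + (t.toFun y y).re := by
  rw [t.add_left _ _ _ hx hy (t.dom.add_mem hx hy), t.add_right _ _ _ hx hx hy,
    t.add_right _ _ _ hy hx hy, ← t.conj_apply hx hy]
  simp only [Complex.add_re, Complex.conj_re]
  ring

theorem im_apply (t : PBF H) {x y : H} (hx : x ∈ t.dom) (hy : y ∈ t.dom) :
    (t.toFun x y).im = (t.toFun x (Complex.I • y)).re := by
  simp [t.smul_right _ _ _ hx hy]

theorem norm_apply_le (t : PBF H) {c : ℝ} (hc : 0 ≤ c)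
    (h : ∀ x ∈ t.dom, (t.toFun x x).re ≤ c * ‖x‖ ^ 2) {x y : H}
    (hx : x ∈ t.dom) (hy : y ∈ t.dom) : ‖t.toFun x y‖ ≤ c * ‖x‖ * ‖y‖ := by
  let core : PreInnerProductSpace.Core ℂ t.dom :=
    { inner := fun a b => t.toFun b a
      conj_inner_symm := fun a b => t.conj_apply a.2 b.2
      re_inner_nonneg := fun a => t.re_nonneg a a.2
      add_left := fun a b d => t.add_right _ _ _ d.2 a.2 b.2
      smul_left := fun a b r => t.smul_right _ _ _ b.2 a.2 }
  have key : ‖t.toFun y x‖ * ‖t.toFun x y‖ ≤ (t.toFun x x).re * (t.toFun y y).re :=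
    InnerProductSpace.Core.inner_mul_inner_self_le (c := core) ⟨x, hx⟩ ⟨y, hy⟩
  rw [← t.conj_apply hx hy, RCLike.norm_conj] at key
  apply abs_le_of_sq_le_sq' _ (by positivity) |>.2
  calc ‖t.toFun x y‖ ^ 2 ≤ (t.toFun x x).re * (t.toFun y y).re := by rw [sq]; exact key
    _ ≤ (c * ‖x‖ ^ 2) * (c * ‖y‖ ^ 2) :=
      mul_le_mul (h x hx) (h y hy) (t.re_nonneg y hy) (by positivity)
    _ = (c * ‖x‖ * ‖y‖) ^ 2 := by ring

theorem Bounded.exists_nonneg {t : PBF H} (h : t.Bounded) :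
    ∃ c : ℝ, 0 ≤ c ∧ ∀ x ∈ t.dom, (t.toFun x x).re ≤ c * ‖x‖ ^ 2 := by
  obtain ⟨c, hc⟩ := h
  exact ⟨max c 0, le_max_right _ _, fun x hx => (hc x hx).trans (by gcongr; exact le_max_left _ _)⟩

/-- A bounded form is the restriction of a continuous sesquilinear map. -/
theorem Bounded.exists_clm {t : PBF H} (h : t.Bounded) :
    ∃ B : H →L⋆[ℂ] H →L[ℂ] ℂ, ∀ x ∈ t.dom, ∀ y ∈ t.dom, B y x = t.toFun x y := by
  obtain ⟨c, hc, hb⟩ := h.exists_nonneg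
  have hdense : DenseRange t.dom.subtypeL := by
    simpa [DenseRange] using t.dense'
  have hind : IsUniformInducing t.dom.subtypeL := isUniformEmbedding_subtype_val.isUniformInducing
  let B₀ : t.dom →L[ℂ] t.dom →L⋆[ℂ] ℂ := LinearMap.mkContinuous₂
    (LinearMap.mk₂'ₛₗ (RingHom.id ℂ) (starRingEnd ℂ) (fun x y : t.dom => t.toFun x y)
      (fun x y z => t.add_left _ _ _ x.2 y.2 z.2) (fun a x y => t.smul_left _ _ _ x.2 y.2)
      (fun x y z => t.add_right _ _ _ x.2 y.2 z.2) (fun a x y => t.smul_right _ _ _ x.2 y.2))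
    c (fun x y => t.norm_apply_le hc hb x.2 y.2)
  let B₁ : H →L[ℂ] t.dom →L⋆[ℂ] ℂ := B₀.extend t.dom.subtypeL
  refine ⟨B₁.flip.extend t.dom.subtypeL, fun x hx y hy => ?_⟩
  have h1 : B₁ x = B₀ ⟨x, hx⟩ := B₀.extend_eq hdense hind ⟨x, hx⟩
  have h2 : B₁.flip.extend t.dom.subtypeL y = B₁.flip ⟨y, hy⟩ :=
    B₁.flip.extend_eq hdense hind ⟨y, hy⟩
  rw [h2, ContinuousLinearMap.flip_apply, h1]
  rfl

theorem continuous_apply_self (B : H →L⋆[ℂ] H →L[ℂ] ℂ) : Continuous fun x => B x x := by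
  fun_prop

/-- Every form extends to an element of `𝓥_f(𝓗)`: bounded forms extend by continuity. -/
theorem exists_inVf_extends (t : PBF H) :
    ∃ s : PBF H, s.InVf ∧ s.Extends t ∧
      ((t.Bounded ∧ s.Bounded ∧ s.dom = ⊤) ∨ (¬ t.Bounded ∧ s.dom = t.dom)) := by
  by_cases h : t.Bounded
  · obtain ⟨B, hB⟩ := h.exists_clm
    have hcont := continuous_apply_self B
    have hpos : ∀ x, 0 ≤ (B x x).re ∧ (B x x).im = 0 := fun x => by
      refine t.dense'.induction (P := fun x => 0 ≤ (B x x).re ∧ (B x x).im = 0)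
        (fun x hx => ?_) ?_ x
      · rw [hB x hx x hx]
        exact ⟨t.re_nonneg x hx, t.im_zero x hx⟩
      · exact (isClosed_le continuous_const (Complex.continuous_re.comp hcont)).inter
          (isClosed_eq (Complex.continuous_im.comp hcont) continuous_const)
    let s : PBF H := ofMapOn ⊤ (by simp) (fun x y => B y x) (by simp) (by simp)
      (by simp) (by simp) (fun x _ => (hpos x).1) (fun x _ => (hpos x).2)
    have hs : ∀ x y, s.toFun x y = B y x := fun x y => by simp [s, ofMapOn]
    refine ⟨s, fun _ => rfl, ⟨le_top, fun x y hx hy => ?_⟩, Or.inl ⟨h, ⟨‖B‖, ?_⟩, rfl⟩⟩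
    · rw [hs, hB x hx y hy]
    · intro x _
      rw [hs]
      calc (B x x).re ≤ ‖B x x‖ := Complex.re_le_norm _
        _ ≤ ‖B‖ * ‖x‖ * ‖x‖ := B.le_opNorm₂ x x
        _ = ‖B‖ * ‖x‖ ^ 2 := by ring
  · exact ⟨t, fun hb => absurd hb h, ⟨le_rfl, fun _ _ _ _ => rfl⟩, Or.inr ⟨h, rfl⟩⟩

/-- The inequality between bounded everywhere defined forms may be checked on a dense set. -/
theorem re_le_of_dense {s t : PBF H} (hs : s.Bounded) (ht : t.Bounded) (hsd : s.dom = ⊤)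
    (htd : t.dom = ⊤) {D : Set H} (hD : Dense D)
    (h : ∀ x ∈ D, (s.toFun x x).re ≤ (t.toFun x x).re) (x : H) :
    (s.toFun x x).re ≤ (t.toFun x x).re := by
  obtain ⟨S, hS⟩ := hs.exists_clm
  obtain ⟨T, hT⟩ := ht.exists_clm
  have hS' : ∀ x, s.toFun x x = S x x := fun x => (hS x (by simp [hsd]) x (by simp [hsd])).symm
  have hT' : ∀ x, t.toFun x x = T x x := fun x => (hT x (by simp [htd]) x (by simp [htd])).symm
  simp only [hS', hT'] at h ⊢
  exact hD.induction (P := fun x => (S x x).re ≤ (T x x).re) h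
    (isClosed_le (Complex.continuous_re.comp (continuous_apply_self S))
      (Complex.continuous_re.comp (continuous_apply_self T))) x

/-- The difference of a form and a smaller one, on the domain of the former. -/
theorem exists_sub {s t : PBF H} (hdom : t.dom ≤ s.dom)
    (hle : ∀ x ∈ t.dom, (s.toFun x x).re ≤ (t.toFun x x).re) :
    ∃ r : PBF H, r.dom = t.dom ∧
      ∀ x ∈ t.dom, ∀ y ∈ t.dom, t.toFun x y = s.toFun x y + r.toFun x y := by
  refine ⟨ofMapOn t.dom t.dense' (fun x y => t.toFun x y - s.toFun x y) ?_ ?_ ?_ ?_ ?_ ?_, rfl,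
    fun x hx y hy => by simp [ofMapOn, hx, hy]⟩
  · intro x hx y hy z hz
    rw [t.add_left _ _ _ hx hy hz, s.add_left _ _ _ (hdom hx) (hdom hy) (hdom hz)]
    ring
  · intro a x hx y hy
    rw [t.smul_left _ _ _ hx hy, s.smul_left _ _ _ (hdom hx) (hdom hy)]
    ring
  · intro x hx y hy z hz
    rw [t.add_right _ _ _ hx hy hz, s.add_right _ _ _ (hdom hx) (hdom hy) (hdom hz)]
    ring
  · intro a x hx y hy
    rw [t.smul_right _ _ _ hx hy, s.smul_right _ _ _ (hdom hx) (hdom hy)]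
    ring
  · intro x hx
    simpa using hle x hx
  · intro x hx
    simp [t.im_zero x hx, s.im_zero x (hdom hx)]

/-- The induced order of `𝓥_f(𝓗)` in terms of domains and quadratic forms. -/
theorem leVf_iff {s t : PBF H} (hs : s.InVf) (ht : t.InVf) :
    leVf s t ↔ (t.dom = s.dom ∨ s.Bounded) ∧ t.dom ≤ s.dom ∧
      ∀ x ∈ t.dom, (s.toFun x x).re ≤ (t.toFun x x).re := by
  constructor
  · rintro ⟨r, hr, hdef, hdom, hsum⟩
    refine ⟨?_, hdom.le.trans inf_le_left, fun x hx => ?_⟩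
    · rcases hdef with h | h | h
      · exact Or.inr h
      · left; rw [hdom, hr h, inf_top_eq]
      · left; rw [hdom, ← h, inf_idem]
    · rw [hsum x x hx hx, Complex.add_re]
      have := r.re_nonneg x (hdom.le.trans inf_le_right hx)
      linarith
  · rintro ⟨hor, hdom, hle⟩
    obtain ⟨r₀, hr₀, hsum⟩ := exists_sub hdom hle
    obtain ⟨r, hr, ⟨hsub, hext⟩, ⟨hb₀, hb, htop⟩ | ⟨hb₀, hrd⟩⟩ := r₀.exists_inVf_extends
    · refine ⟨r, hr, Or.inr (Or.inl hb), ?_, fun x y hx hy => ?_⟩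
      · rw [htop, inf_top_eq]
        refine hor.elim id fun hsb => ?_
        have htb : t.Bounded := by
          obtain ⟨a, ha⟩ := hsb
          obtain ⟨b, hb⟩ := hb₀
          refine ⟨a + b, fun x hx => ?_⟩
          rw [hsum x hx x hx, Complex.add_re, add_mul]
          exact add_le_add (ha x (hdom hx)) (hb x (hr₀ ▸ hx))
        rw [ht htb, hs hsb]
      · rw [hsum x hx y hy, hext x y (hr₀ ▸ hx) (hr₀ ▸ hy)]
    · refine ⟨r, hr, ?_, ?_, fun x y hx hy => ?_⟩
      · exact hor.elim (fun h => Or.inr (Or.inr (by rw [hrd, hr₀, h]))) Or.inl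
      · rw [hrd, hr₀, inf_eq_right.2 hdom]
      · rw [hsum x hx y hy, hext x y (hr₀ ▸ hx) (hr₀ ▸ hy)]

/-- A sequence of forms which is non-increasing on a common dense domain converges there
to a positive form. -/
theorem exists_tendsto (D : Submodule ℂ H) (hD : Dense (D : Set H)) (g : ℕ → PBF H)
    (hg : ∀ n, (g n).dom = D)
    (hanti : ∀ x ∈ D, Antitone fun n => ((g n).toFun x x).re) :
    ∃ t : PBF H, t.dom = D ∧
      ∀ x ∈ D, ∀ y ∈ D, Tendsto (fun n => (g n).toFun x y) atTop (𝓝 (t.toFun x y)) := by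
  have hdiag : ∀ x ∈ D, ∃ a : ℝ, Tendsto (fun n => ((g n).toFun x x).re) atTop (𝓝 a) := by
    intro x hx
    refine ⟨_, tendsto_atTop_ciInf (hanti x hx) ⟨0, ?_⟩⟩
    rintro _ ⟨n, rfl⟩
    exact (g n).re_nonneg x (by rwa [hg])
  have hre : ∀ x ∈ D, ∀ y ∈ D,
      ∃ a : ℝ, Tendsto (fun n => ((g n).toFun x y).re) atTop (𝓝 a) := by
    intro x hx y hy
    obtain ⟨a, ha⟩ := hdiag x hx
    obtain ⟨b, hb⟩ := hdiag y hy
    obtain ⟨d, hd⟩ := hdiag (x + y) (D.add_mem hx hy)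
    refine ⟨(d - a - b) / 2, (((hd.sub ha).sub hb).div_const 2).congr fun n => ?_⟩
    rw [(g n).re_add_apply (by rwa [hg]) (by rwa [hg])]
    ring
  have hlim : ∀ x y, ∃ a : ℂ, x ∈ D → y ∈ D →
      Tendsto (fun n => (g n).toFun x y) atTop (𝓝 a) := by
    intro x y
    by_cases h : x ∈ D ∧ y ∈ D
    · obtain ⟨hx, hy⟩ := h
      obtain ⟨a, ha⟩ := hre x hx y hy
      obtain ⟨b, hb⟩ := hre x hx _ (D.smul_mem Complex.I hy)
      refine ⟨a + b * Complex.I, fun _ _ => ?_⟩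
      refine (((Complex.continuous_ofReal.tendsto a).comp ha).add
        (((Complex.continuous_ofReal.tendsto b).comp hb).mul_const Complex.I)).congr fun n => ?_
      simp only [Function.comp_apply]
      rw [← (g n).im_apply (by rwa [hg]) (by rwa [hg]), Complex.re_add_im]
    · exact ⟨0, fun hx hy => absurd ⟨hx, hy⟩ h⟩
  choose L hL using hlim
  refine ⟨ofMapOn D hD L ?_ ?_ ?_ ?_ ?_ ?_, rfl, fun x hx y hy => by
    simpa [ofMapOn, hx, hy] using hL x y hx hy⟩
  · intro x hx y hy z hz
    refine tendsto_nhds_unique (hL _ _ (D.add_mem hx hy) hz)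
      (((hL x z hx hz).add (hL y z hy hz)).congr fun n => ?_)
    rw [(g n).add_left] <;> rwa [hg]
  · intro a x hx y hy
    refine tendsto_nhds_unique (hL _ _ (D.smul_mem a hx) hy)
      (((hL x y hx hy).const_mul a).congr fun n => ?_)
    rw [(g n).smul_left] <;> rwa [hg]
  · intro x hx y hy z hz
    refine tendsto_nhds_unique (hL _ _ hx (D.add_mem hy hz))
      (((hL x y hx hy).add (hL x z hx hz)).congr fun n => ?_)
    rw [(g n).add_right] <;> rwa [hg]
  · intro a x hx y hy
    refine tendsto_nhds_unique (hL _ _ hx (D.smul_mem a hy))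
      (((hL x y hx hy).const_mul (conj a)).congr fun n => ?_)
    rw [(g n).smul_right] <;> rwa [hg]
  · intro x hx
    exact ge_of_tendsto' ((Complex.continuous_re.tendsto _).comp (hL x x hx hx))
      fun n => (g n).re_nonneg x (by rwa [hg])
  · intro x hx
    exact tendsto_nhds_unique ((Complex.continuous_im.tendsto _).comp (hL x x hx hx))
      (tendsto_const_nhds.congr fun n => ((g n).im_zero x (by rwa [hg])).symm)

/-- The domains of a non-increasing sequence in `𝓥_f(𝓗)` grow, and they are eventually constant:
they either all agree or become the whole space once the forms are bounded. -/
theorem exists_eventual_dom {f : ℕ → PBF H} (hf : ∀ n, (f n).InVf)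
    (hmono : ∀ n, leVf (f (n + 1)) (f n)) :
    ∃ N, (∀ n, N ≤ n → (f n).dom = (f N).dom) ∧
      ((∀ n, (f n).dom = (f N).dom) ∨ ((f N).Bounded ∧ (f N).dom = ⊤)) := by
  have hstep := fun n => (leVf_iff (hf (n + 1)) (hf n)).1 (hmono n)
  have hdom : Monotone fun n => (f n).dom := monotone_nat_of_le_succ fun n => (hstep n).2.1
  by_cases h : ∃ N, (f N).Bounded
  · obtain ⟨N, hN⟩ := h
    have htop := hf N hN
    refine ⟨N, fun n hn => ?_, Or.inr ⟨hN, htop⟩⟩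
    rw [htop]
    exact top_le_iff.1 (htop ▸ hdom hn)
  · push Not at h
    have hc : ∀ n, (f n).dom = (f 0).dom := fun n => by
      induction n with
      | zero => rfl
      | succ k ih => rw [← ((hstep k).1.resolve_right (h _)), ih]
    exact ⟨0, fun n _ => hc n, Or.inl hc⟩

end PBF

open PBF

/-- `(𝓥_f(𝓗); ⊕, o)` is monotone Dedekind downwards σ-complete: every
non-increasing sequence `t₁ ≥ t₂ ≥ ⋯` in `𝓥_f(𝓗)` has an infimum `t` in `𝓥_f(𝓗)`, and
`t(u,v) = lim_{n→∞} tₙ(u,v)` for all `u, v` in the common eventual domain of the `tₙ`. -/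
theorem stmt_14 [CompleteSpace H] (h_inf : ¬ FiniteDimensional ℂ H)
    (f : ℕ → PBF H) (hf : ∀ n, (f n).InVf)
    (hmono : ∀ n, leVf (f (n + 1)) (f n)) :
    ∃ t : PBF H, t.InVf ∧
      -- `t` is a lower bound
      (∀ n, leVf t (f n)) ∧
      -- and the greatest one
      (∀ s : PBF H, s.InVf → (∀ n, leVf s (f n)) → leVf s t) ∧
      -- `t` is the pointwise limit on the common eventual domain
      (∀ u v : H, (∀ᶠ n in Filter.atTop, u ∈ (f n).dom ∧ v ∈ (f n).dom) →
        Filter.Tendsto (fun n => (f n).toFun u v) Filter.atTop (nhds (t.toFun u v))) := by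
  have hstep := fun n => (leVf_iff (hf (n + 1)) (hf n)).1 (hmono n)
  have hdom : Monotone fun n => (f n).dom := monotone_nat_of_le_succ fun n => (hstep n).2.1
  have hle : ∀ m n, m ≤ n → ∀ x ∈ (f m).dom,
      ((f n).toFun x x).re ≤ ((f m).toFun x x).re := by
    intro m n hmn x hx
    induction n, hmn using Nat.le_induction with
    | base => rfl
    | succ k hk ih => exact ((hstep k).2.2 x (hdom hk hx)).trans ih
  obtain ⟨N, hconst, hN⟩ := exists_eventual_dom hf hmono
  have hsub : ∀ n, (f n).dom ≤ (f N).dom := fun n =>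
    (hdom (le_max_left n N)).trans (hconst _ (le_max_right n N)).le
  obtain ⟨t₀, ht₀, hlim'⟩ := exists_tendsto (f N).dom (f N).dense' (fun n => f (n + N))
    (fun n => hconst _ (Nat.le_add_left N n)) (fun x hx m n hmn =>
      hle _ _ (Nat.add_le_add_right hmn N) x (hdom (Nat.le_add_left N m) hx))
  have hlim : ∀ x ∈ (f N).dom, ∀ y ∈ (f N).dom,
      Tendsto (fun n => (f n).toFun x y) atTop (nhds (t₀.toFun x y)) := fun x hx y hy =>
    (tendsto_add_atTop_iff_nat N).1 (hlim' x hx y hy)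
  have hre : ∀ x ∈ (f N).dom,
      Tendsto (fun n => ((f n).toFun x x).re) atTop (nhds (t₀.toFun x x).re) := fun x hx =>
    (Complex.continuous_re.tendsto _).comp (hlim x hx x hx)
  have ht₀le : ∀ n, ∀ x ∈ (f n).dom, (t₀.toFun x x).re ≤ ((f n).toFun x x).re := fun n x hx =>
    le_of_tendsto (hre x (hsub n hx))
      ((eventually_ge_atTop n).mono fun m hm => hle n m hm x hx)
  obtain ⟨t, ht, ⟨htsub, htext⟩, hcase⟩ := t₀.exists_inVf_extends
  rw [ht₀] at htsub htext
  refine ⟨t, ht, fun n => ?_, fun s hs hsf => ?_, fun u v huv => ?_⟩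
  · refine (leVf_iff ht (hf n)).2 ⟨?_, (hsub n).trans htsub, fun x hx => ?_⟩
    · rcases hcase with ⟨-, hb, -⟩ | ⟨hb, htd⟩
      · exact Or.inr hb
      · rcases hN with h | ⟨⟨c, hc⟩, -⟩
        · left; rw [htd, ht₀, h]
        · exact absurd ⟨c, fun x hx => (ht₀le N x (ht₀ ▸ hx)).trans (hc x (ht₀ ▸ hx))⟩ hb
    · rw [htext x x (hsub n hx) (hsub n hx)]
      exact ht₀le n x hx
  · have hsf' := fun n => (leVf_iff hs (hf n)).1 (hsf n)
    have hst₀ : ∀ x ∈ (f N).dom, (s.toFun x x).re ≤ (t₀.toFun x x).re := fun x hx =>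
      ge_of_tendsto (hre x hx) ((eventually_ge_atTop N).mono fun n hn =>
        (hsf' n).2.2 x (hdom hn hx))
    have hst : ∀ x ∈ (f N).dom, (s.toFun x x).re ≤ (t.toFun x x).re := fun x hx => by
      rw [htext x x hx hx]; exact hst₀ x hx
    refine (leVf_iff hs ht).2 ?_
    rcases hcase with ⟨⟨c, hc⟩, hb, htop⟩ | ⟨-, htd⟩
    · have hsb : s.Bounded := (hsf' N).1.elim (fun h => ⟨c, fun x hx =>
        (hst₀ x (h ▸ hx)).trans (hc x (by rw [ht₀, h]; exact hx))⟩) id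
      exact ⟨Or.inr hsb, by rw [hs hsb]; exact le_top,
        fun x _ => re_le_of_dense hsb hb (hs hsb) htop (f N).dense' hst x⟩
    · rw [htd, ht₀]
      exact ⟨(hsf' N).1, (hsf' N).2.1, hst⟩
  · obtain ⟨n, hu, hv⟩ := huv.exists
    rw [htext u v (hsub n hu) (hsub n hv)]
    exact hlim u (hsub n hu) v (hsub n hv)
end
end

section
/- Let 𝓗 be an infinite-dimensional complex Hilbert space. Then the generalized effect algebras (𝓡_f(𝓗); ⊕|_{𝓡_f(𝓗)}, o) and (𝓒_f(𝓗); ⊕|_{𝓒_f(𝓗)}, o) are not monotone Dedekind downwards σ-complete: in each of them there exists a non-increasing sequence (with respect to the induced order) that has no infimum. -/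
set_option autoImplicit false

noncomputable section

open Filter

variable {H : Type*}

variable [NormedAddCommGroup H] [InnerProductSpace ℂ H]

lemma mul_inner_self_add_mul_inner_mul_inner (a c : ℝ) (g u : H) :
    (a : ℂ) * inner ℂ u u + c * (inner ℂ g u * inner ℂ u g) =
      ((a * ‖u‖ ^ 2 + c * ‖inner ℂ g u‖ ^ 2 : ℝ) : ℂ) := by
  rw [inner_self_eq_norm_sq_to_K, ← inner_conj_symm u g, Complex.mul_conj']
  push_cast
  rfl

/-- The form `(T u, T v) ↦ a ⟨u, v⟩ + c ⟨u, g⟩ ⟨g, v⟩` on the dense range of an injective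
operator `T`, where `⟨·,·⟩` is linear in the first argument. -/
def rangeForm (T : H →L[ℂ] H) (hinj : Function.Injective T) (hd : DenseRange T) (g : H)
    (a c : ℝ) (h : ∀ u : H, 0 ≤ a * ‖u‖ ^ 2 + c * ‖inner ℂ g u‖ ^ 2) : PBF H := by
  classical
  have hi : ∀ u, Function.invFun T (T u) = u := Function.leftInverse_invFun hinj
  exact
  { dom := T.range
    dense' := hd
    toFun := fun x y => if x ∈ T.range ∧ y ∈ T.range then
      (a : ℂ) * inner ℂ (Function.invFun T y) (Function.invFun T x) +
        c * (inner ℂ g (Function.invFun T x) * inner ℂ (Function.invFun T y) g) else 0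
    zero_off := by
      intro x y hxy
      rw [if_neg]
      tauto
    add_left := by
      rintro _ _ _ ⟨u, rfl⟩ ⟨v, rfl⟩ ⟨w, rfl⟩
      have hs : T u + T v = T (u + v) := (map_add T u v).symm
      simp only [ContinuousLinearMap.coe_coe, hs, LinearMap.mem_range, exists_apply_eq_apply,
        and_self, if_true, hi, inner_add_right]
      ring
    smul_left := by
      rintro k _ _ ⟨u, rfl⟩ ⟨v, rfl⟩
      have hs : k • T u = T (k • u) := (map_smul T k u).symm
      simp only [ContinuousLinearMap.coe_coe, hs, LinearMap.mem_range, exists_apply_eq_apply,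
        and_self, if_true, hi, inner_smul_right]
      ring
    add_right := by
      rintro _ _ _ ⟨u, rfl⟩ ⟨v, rfl⟩ ⟨w, rfl⟩
      have hs : T v + T w = T (v + w) := (map_add T v w).symm
      simp only [ContinuousLinearMap.coe_coe, hs, LinearMap.mem_range, exists_apply_eq_apply,
        and_self, if_true, hi, inner_add_left]
      ring
    smul_right := by
      rintro k _ _ ⟨u, rfl⟩ ⟨v, rfl⟩
      have hs : k • T v = T (k • v) := (map_smul T k v).symm
      simp only [ContinuousLinearMap.coe_coe, hs, LinearMap.mem_range, exists_apply_eq_apply,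
        and_self, if_true, hi, inner_smul_left]
      ring
    re_nonneg := by
      rintro _ ⟨u, rfl⟩
      simp only [ContinuousLinearMap.coe_coe, LinearMap.mem_range, exists_apply_eq_apply,
        and_self, if_true, hi,
        mul_inner_self_add_mul_inner_mul_inner, Complex.ofReal_re]
      exact h u
    im_zero := by
      rintro _ ⟨u, rfl⟩
      simp only [ContinuousLinearMap.coe_coe, LinearMap.mem_range, exists_apply_eq_apply,
        and_self, if_true, hi,
        mul_inner_self_add_mul_inner_mul_inner, Complex.ofReal_im] }

section RangeForm

variable {T : H →L[ℂ] H} {hinj : Function.Injective T} {hd : DenseRange T} {g : H} {a c : ℝ}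
  {h : ∀ u : H, 0 ≤ a * ‖u‖ ^ 2 + c * ‖inner ℂ g u‖ ^ 2}

lemma rangeForm_dom : (rangeForm T hinj hd g a c h).dom = T.range := rfl

lemma rangeForm_apply (u v : H) : (rangeForm T hinj hd g a c h).toFun (T u) (T v) =
    a * inner ℂ v u + c * (inner ℂ g u * inner ℂ v g) := by
  have hi : ∀ u, Function.invFun T (T u) = u := Function.leftInverse_invFun hinj
  simp [rangeForm, hi]

lemma rangeForm_apply_self (u : H) : ((rangeForm T hinj hd g a c h).toFun (T u) (T u)).re =
    a * ‖u‖ ^ 2 + c * ‖inner ℂ g u‖ ^ 2 := by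
  rw [rangeForm_apply, mul_inner_self_add_mul_inner_mul_inner, Complex.ofReal_re]

lemma rangeForm_isClosedForm [CompleteSpace H] {m : ℝ} (hm : 0 < m)
    (hc : ∀ u : H, m * ‖u‖ ^ 2 ≤ a * ‖u‖ ^ 2 + c * ‖inner ℂ g u‖ ^ 2) :
    (rangeForm T hinj hd g a c h).IsClosedForm := by
  intro f hf hcau
  choose v hv using fun n => (hf n : f n ∈ T.range)
  obtain rfl : f = fun n => T (v n) := funext fun n => (hv n).symm
  have hq : ∀ w : H, (rangeForm T hinj hd g a c h).q (T w) =
      a * ‖w‖ ^ 2 + c * ‖inner ℂ g w‖ ^ 2 + ‖T w‖ ^ 2 := fun w => by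
    rw [PBF.q, rangeForm_apply_self]
  simp only [← map_sub, hq] at hcau
  have hv : CauchySeq v := by
    rw [Metric.cauchySeq_iff]
    intro ε hε
    obtain ⟨N, hN⟩ := hcau (m * ε ^ 2) (by positivity)
    refine ⟨N, fun k hk n hn => ?_⟩
    have h1 := hN k hk n hn
    have h2 := hc (v k - v n)
    have h3 : m * ‖v k - v n‖ ^ 2 < m * ε ^ 2 := by
      nlinarith [sq_nonneg ‖T (v k - v n)‖]
    rw [dist_eq_norm]
    exact lt_of_pow_lt_pow_left₀ 2 hε.le (lt_of_mul_lt_mul_left h3 hm.le)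
  obtain ⟨w, hw⟩ := cauchySeq_tendsto_of_complete hv
  refine ⟨T w, ⟨w, rfl⟩, ?_⟩
  simp only [← map_sub, hq]
  have hcont : Continuous fun w : H =>
      a * ‖w‖ ^ 2 + c * ‖inner ℂ g w‖ ^ 2 + ‖T w‖ ^ 2 := by fun_prop
  have h0 : Tendsto (fun n => v n - w) atTop (nhds 0) := by
    simpa using hw.sub_const w
  have h1 := (hcont.tendsto 0).comp h0
  rwa [map_zero, inner_zero_right, norm_zero, norm_zero, zero_pow two_ne_zero, mul_zero, mul_zero,
    add_zero, add_zero] at h1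

lemma rangeForm_not_bounded {m : ℝ} (hm : 0 < m)
    (hc : ∀ u : H, m * ‖u‖ ^ 2 ≤ a * ‖u‖ ^ 2 + c * ‖inner ℂ g u‖ ^ 2)
    {u : ℕ → H} (hu : ∀ n, inner ℂ g (u n) = 1)
    (hT : Tendsto (fun n => T (u n)) atTop (nhds 0)) :
    ¬ (rangeForm T hinj hd g a c h).Bounded := by
  rintro ⟨C, hC⟩
  have hlim : Tendsto (fun n => ‖g‖ ^ 2 * (C * ‖T (u n)‖ ^ 2)) atTop (nhds 0) := by
    simpa using ((hT.norm.pow 2).const_mul C).const_mul (‖g‖ ^ 2)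
  have hle : ∀ n, m ≤ ‖g‖ ^ 2 * (C * ‖T (u n)‖ ^ 2) := fun n => by
    have h1 := hC (T (u n)) ⟨u n, rfl⟩
    rw [rangeForm_apply_self] at h1
    have h2 : (1 : ℝ) ≤ ‖g‖ * ‖u n‖ := by
      simpa [hu n] using norm_inner_le_norm (𝕜 := ℂ) g (u n)
    have h3 : (1 : ℝ) ≤ ‖g‖ ^ 2 * ‖u n‖ ^ 2 := by
      rw [← mul_pow]
      exact one_le_pow₀ h2
    calc m ≤ m * (‖g‖ ^ 2 * ‖u n‖ ^ 2) := le_mul_of_one_le_right hm.le h3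
      _ = ‖g‖ ^ 2 * (m * ‖u n‖ ^ 2) := by ring
      _ ≤ _ := mul_le_mul_of_nonneg_left ((hc (u n)).trans h1) (sq_nonneg _)
  exact absurd (ge_of_tendsto' hlim hle) (not_le.mpr hm)

lemma rangeForm_oplus {a₁ a₂ c₁ c₂ : ℝ}
    {h₁ : ∀ u : H, 0 ≤ a₁ * ‖u‖ ^ 2 + c₁ * ‖inner ℂ g u‖ ^ 2}
    {h₂ : ∀ u : H, 0 ≤ a₂ * ‖u‖ ^ 2 + c₂ * ‖inner ℂ g u‖ ^ 2}
    (ha : a = a₁ + a₂) (hc : c = c₁ + c₂) :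
    PBF.Oplus (rangeForm T hinj hd g a₁ c₁ h₁) (rangeForm T hinj hd g a₂ c₂ h₂)
      (rangeForm T hinj hd g a c h) := by
  refine ⟨Or.inr (Or.inr rfl), (inf_idem _).symm, ?_⟩
  rintro _ _ ⟨u, rfl⟩ ⟨v, rfl⟩
  subst ha hc
  simp only [ContinuousLinearMap.coe_coe, rangeForm_apply]
  push_cast
  ring

end RangeForm

/-- A form which on the range of `T` is the square of a discontinuous functional is not
closable. -/
lemma not_closable_of_sq_functional {T : H →L[ℂ] H} {g : H} {u : ℕ → H}
    (hu : ∀ n, inner ℂ g (u n) = 1) (hT : Tendsto (fun n => T (u n)) atTop (nhds 0))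
    {r : PBF H} (hdom : T.range ≤ r.dom)
    (hr : ∀ v, (r.toFun (T v) (T v)).re = ‖inner ℂ g v‖ ^ 2) : ¬ r.Closable := by
  rintro ⟨s, hs, hle, hext⟩
  have hmem : ∀ v, T v ∈ r.dom := fun v => hdom ⟨v, rfl⟩
  have hq : ∀ v, s.q (T v) = ‖inner ℂ g v‖ ^ 2 + ‖T v‖ ^ 2 := fun v => by
    rw [PBF.q, hext _ _ (hmem v) (hmem v), hr]
  obtain ⟨y, hy, hlim⟩ := hs (fun n => T (u n)) (fun n => hle (hmem _)) (by
    intro ε hε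
    obtain ⟨N, hN⟩ := Metric.cauchySeq_iff.mp hT.cauchySeq (√ε) (Real.sqrt_pos.mpr hε)
    refine ⟨N, fun k hk n hn => ?_⟩
    have h1 := hN k hk n hn
    rw [dist_eq_norm, ← map_sub] at h1
    rw [← map_sub, hq, inner_sub_right, hu, hu, sub_self]
    simpa using (Real.lt_sqrt (norm_nonneg _)).mp h1)
  have hsq : Tendsto (fun n => ‖T (u n) - y‖ ^ 2) atTop (nhds 0) := by
    refine squeeze_zero (fun n => sq_nonneg _) (fun n => ?_) hlim
    have := s.re_nonneg _ (s.dom.sub_mem (hle (hmem (u n))) hy)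
    simp only [PBF.q]
    linarith
  have h0 : ‖0 - y‖ ^ 2 = (0 : ℝ) :=
    tendsto_nhds_unique ((hT.sub_const y).norm.pow 2) hsq
  obtain rfl : y = 0 := by simpa using h0
  have h1 : ∀ n, (1 : ℝ) ≤ s.q (T (u n) - 0) := fun n => by
    rw [sub_zero, hq, hu]
    simp
  have := ge_of_tendsto' hlim h1
  norm_num at this

/-- In an infinite-dimensional Hilbert space there is an injective bounded operator with dense
range such that some functional `T u ↦ ⟨u, g⟩` on its range is discontinuous. -/
lemma exists_injective_denseRange_discontinuous [CompleteSpace H]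
    (h_inf : ¬ FiniteDimensional ℂ H) :
    ∃ (T : H →L[ℂ] H) (g : H) (u : ℕ → H), Function.Injective T ∧ DenseRange T ∧
      (∀ n, inner ℂ g (u n) = 1) ∧ Tendsto (fun n => T (u n)) atTop (nhds 0) := by
  obtain ⟨w, b, -⟩ := exists_hilbertBasis ℂ H
  have hw : Infinite w := by
    by_contra hfin
    rw [not_infinite_iff_finite] at hfin
    have := Fintype.ofFinite w
    exact h_inf b.toOrthonormalBasis.toBasis.finiteDimensional_of_finite
  set e : ℕ → H := fun n => b (Infinite.natEmbedding w n)
  have he : Orthonormal ℂ e := b.orthonormal.comp _ (Infinite.natEmbedding w).injective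
  have hee : ∀ i j, inner ℂ (e i) (e j) = if i = j then (1 : ℂ) else 0 :=
    orthonormal_iff_ite.mp he
  have hgs : Summable fun n : ℕ => ((1 / 2 : ℂ) ^ n) • e n := by
    refine Summable.of_norm_bounded (g := fun n : ℕ => (1 / 2 : ℝ) ^ n)
      summable_geometric_two fun n => ?_
    simp [norm_smul, he.1 n]
  have hSs : Summable fun n : ℕ => ((1 / 4 : ℂ) ^ n) • (innerSL ℂ (e n)).smulRight (e n) := by
    refine Summable.of_norm_bounded (g := fun n : ℕ => (1 / 4 : ℝ) ^ n)
      (summable_geometric_of_lt_one (by norm_num) (by norm_num)) fun n => ?_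
    rw [norm_smul, ContinuousLinearMap.norm_smulRight_apply, innerSL_apply_norm, he.1 n]
    simp
  set g := ∑' n : ℕ, ((1 / 2 : ℂ) ^ n) • e n
  set S := ∑' n : ℕ, ((1 / 4 : ℂ) ^ n) • (innerSL ℂ (e n)).smulRight (e n)
  have hge : ∀ n, inner ℂ (e n) g = (1 / 2 : ℂ) ^ n := fun n => by
    have h1 := hgs.hasSum.mapL (innerSL ℂ (e n))
    have h2 : (fun k => innerSL ℂ (e n) (((1 / 2 : ℂ) ^ k) • e k)) =
        fun k => if k = n then (1 / 2 : ℂ) ^ n else 0 := by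
      ext k
      rw [innerSL_apply_apply, inner_smul_right, hee]
      by_cases hk : k = n
      · simp [hk]
      · simp [hk, Ne.symm hk]
    rw [h2] at h1
    exact h1.unique (hasSum_ite_eq n _)
  have hSv : ∀ v, HasSum (fun n : ℕ => ((1 / 4 : ℂ) ^ n * inner ℂ (e n) v) • e n) (S v) :=
    fun v => by
      simp only [mul_smul]
      exact hSs.hasSum.mapL (ContinuousLinearMap.apply ℂ H v)
  have hSe : ∀ n, S (e n) = ((1 / 4 : ℂ) ^ n) • e n := fun n => by
    refine (hSv (e n)).unique ?_
    convert hasSum_ite_eq n (((1 / 4 : ℂ) ^ n) • e n) using 2 with k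
    rw [hee]
    by_cases hk : k = n <;> simp [hk]
  have heS : ∀ n v, inner ℂ (e n) (S v) = (1 / 4 : ℂ) ^ n * inner ℂ (e n) v := fun n v => by
    have h1 := (hSv v).mapL (innerSL ℂ (e n))
    have h2 : (fun k => innerSL ℂ (e n) (((1 / 4 : ℂ) ^ k * inner ℂ (e k) v) • e k)) =
        fun k => if k = n then (1 / 4 : ℂ) ^ n * inner ℂ (e n) v else 0 := by
      ext k
      rw [innerSL_apply_apply, inner_smul_right, hee]
      by_cases hk : k = n
      · simp [hk]
      · simp [hk, Ne.symm hk]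
    rw [h2] at h1
    exact h1.unique (hasSum_ite_eq n _)
  set K := Submodule.span ℂ (Set.range e) with hK
  have heK : ∀ n, e n ∈ K := fun n => Submodule.subset_span ⟨n, rfl⟩
  have hKo : ∀ v, (∀ n, inner ℂ (e n) v = 0) → v ∈ Kᗮ := fun v hv => by
    rw [hK, Submodule.mem_orthogonal]
    intro x hx
    induction hx using Submodule.span_induction with
    | mem x hx => obtain ⟨n, rfl⟩ := hx; exact hv n
    | zero => simp
    | add x y _ _ hx hy => rw [inner_add_left, hx, hy, add_zero]
    | smul k x _ hx => rw [inner_smul_left, hx, mul_zero]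
  set T : H →L[ℂ] H := S + Kᗮ.starProjection with hTdef
  have hTe : ∀ n, T (e n) = ((1 / 4 : ℂ) ^ n) • e n := fun n => by
    have : Kᗮ.starProjection (e n) = 0 := by
      rw [Submodule.starProjection_apply_eq_zero_iff]
      exact Submodule.le_orthogonal_orthogonal K (heK n)
    simp [hTdef, this, hSe]
  have hTo : ∀ v ∈ Kᗮ, T v = v := fun v hv => by
    have h1 : S v = 0 := by
      refine (hSv v).unique ?_
      convert hasSum_zero using 2 with n
      rw [(Submodule.mem_orthogonal K v).mp hv _ (heK n)]
      simp
    simp [hTdef, h1, Submodule.starProjection_eq_self_iff.mpr hv]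
  refine ⟨T, g, fun n => ((2 : ℂ) ^ n) • e n, ?_, ?_, ?_, ?_⟩
  · rw [injective_iff_map_eq_zero]
    intro v hv
    have hvK : v ∈ Kᗮ := hKo v fun n => by
      have h1 : inner ℂ (e n) (T v) = (1 / 4 : ℂ) ^ n * inner ℂ (e n) v := by
        rw [hTdef, add_apply, inner_add_right, heS,
          (Submodule.mem_orthogonal K _).mp (Submodule.starProjection_apply_mem Kᗮ v) _ (heK n),
          add_zero]
      rw [hv, inner_zero_right] at h1
      exact (mul_eq_zero.mp h1.symm).resolve_left (by simp)
    rw [← hTo v hvK, hv]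
  · have hd : Dense ((T.range : Submodule ℂ H) : Set H) := by
      rw [Submodule.dense_iff_topologicalClosure_eq_top,
        Submodule.topologicalClosure_eq_top_iff, Submodule.eq_bot_iff]
      intro v hv
      rw [Submodule.mem_orthogonal] at hv
      have hvK : v ∈ Kᗮ := hKo v fun n => by
        have h1 := hv (T (e n)) ⟨e n, rfl⟩
        rw [hTe, inner_smul_left] at h1
        exact (mul_eq_zero.mp h1).resolve_left (by simp)
      have h2 := hv (T v) ⟨v, rfl⟩
      rwa [hTo v hvK, inner_self_eq_zero] at h2
    exact hd
  · intro n
    rw [inner_smul_right, ← inner_conj_symm, hge, map_pow, ← mul_pow]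
    simp [Complex.conj_ofNat]
  · rw [tendsto_zero_iff_norm_tendsto_zero]
    have h1 : ∀ n, ‖T (((2 : ℂ) ^ n) • e n)‖ = (1 / 2 : ℝ) ^ n := fun n => by
      rw [map_smul, hTe, smul_smul, norm_smul, he.1 n, ← mul_pow, norm_pow]
      norm_num
    simp only [h1]
    exact tendsto_pow_atTop_nhds_zero_of_lt_one (by norm_num) (by norm_num)

/-- A class of forms lying between the closed and the closable ones contains a non-increasing
sequence without infimum. -/
lemma exists_antitone_no_inf [CompleteSpace H] (h_inf : ¬ FiniteDimensional ℂ H)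
    (Q : PBF H → Prop) (hQ₁ : ∀ t : PBF H, t.IsClosedForm → Q t)
    (hQ₂ : ∀ t : PBF H, Q t → t.Closable) :
    ∃ f : ℕ → PBF H, (∀ n, MemAlg Q (f n)) ∧ (∀ n, leQ Q (f (n + 1)) (f n)) ∧
      ¬ ∃ i : PBF H, MemAlg Q i ∧ (∀ n, leQ Q i (f n)) ∧
        ∀ z : PBF H, MemAlg Q z → (∀ n, leQ Q z (f n)) → leQ Q z i := by
  obtain ⟨T, g, u, hinj, hd, hu, hT⟩ := exists_injective_denseRange_discontinuous h_inf
  have hmem : ∀ (a c m : ℝ) (hm : 0 < m)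
      (hc : ∀ u : H, m * ‖u‖ ^ 2 ≤ a * ‖u‖ ^ 2 + c * ‖inner ℂ g u‖ ^ 2)
      (h : ∀ u : H, 0 ≤ a * ‖u‖ ^ 2 + c * ‖inner ℂ g u‖ ^ 2),
      MemAlg Q (rangeForm T hinj hd g a c h) := fun a c m hm hc h =>
    ⟨fun hb => absurd hb (rangeForm_not_bounded hm hc hu hT),
      hQ₁ _ (rangeForm_isClosedForm hm hc)⟩
  have hpos : ∀ {a c : ℝ}, 0 ≤ a → 0 ≤ c →
      ∀ u : H, 0 ≤ a * ‖u‖ ^ 2 + c * ‖inner ℂ g u‖ ^ 2 := fun ha hc u => by positivity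
  have hmem' : ∀ (a c : ℝ) (ha : 0 < a) (hc : 0 ≤ c),
      MemAlg Q (rangeForm T hinj hd g a c (hpos ha.le hc)) := fun a c ha hc =>
    hmem a c a ha (fun u => le_add_of_nonneg_right (by positivity)) _
  set M : ℝ := ‖g‖ ^ 2 + 1 with hM
  have hM0 : 0 < M := by positivity
  have hco : ∀ u : H, 1 * ‖u‖ ^ 2 ≤ M * ‖u‖ ^ 2 + (-1) * ‖inner ℂ g u‖ ^ 2 := fun u => by
    have h1 := pow_le_pow_left₀ (norm_nonneg _) (norm_inner_le_norm (𝕜 := ℂ) g u) 2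
    rw [mul_pow] at h1
    rw [hM]
    linarith
  have hz : ∀ u : H, 0 ≤ M * ‖u‖ ^ 2 + (-1) * ‖inner ℂ g u‖ ^ 2 := fun u =>
    le_trans (by positivity) (hco u)
  have hδ : ∀ n : ℕ, (0 : ℝ) < 1 / ((n : ℝ) + 1) := fun n => Nat.one_div_pos_of_nat
  have hδ' : ∀ n : ℕ, (0 : ℝ) < 1 / ((n : ℝ) + 1) - 1 / (((n + 1 : ℕ) : ℝ) + 1) := fun n =>
    sub_pos.mpr (Nat.one_div_lt_one_div n.lt_succ_self)
  refine ⟨fun n => rangeForm T hinj hd g (M + 1 / ((n : ℝ) + 1)) 0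
    (hpos (add_pos hM0 (hδ n)).le le_rfl), fun n => hmem' _ _ (add_pos hM0 (hδ n)) le_rfl,
    fun n => ⟨_, hmem' _ 0 (hδ' n) le_rfl, rangeForm_oplus (by ring) (by ring)⟩, ?_⟩
  rintro ⟨i, -, hif, hi⟩
  obtain ⟨r, -, -, hrdom, hr⟩ := hi (rangeForm T hinj hd g M 0 (hpos hM0.le le_rfl))
    (hmem' _ _ hM0 le_rfl)
    fun n => ⟨_, hmem' _ 0 (hδ n) le_rfl, rangeForm_oplus rfl (by ring)⟩
  obtain ⟨r', ⟨-, hr'Q⟩, -, hr'dom, hr'⟩ := hi (rangeForm T hinj hd g M (-1) hz)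
    (hmem _ _ 1 one_pos hco hz)
    fun n => ⟨_, hmem' _ 1 (hδ n) zero_le_one, rangeForm_oplus rfl (by ring)⟩
  have hDi : T.range ≤ i.dom := by
    obtain ⟨_, -, -, h1, -⟩ := hif 0
    exact h1.le.trans inf_le_left
  have hTi : ∀ v, T v ∈ i.dom := fun v => hDi ⟨v, rfl⟩
  have hir : i.dom ≤ r.dom := hrdom.le.trans inf_le_right
  have hir' : i.dom ≤ r'.dom := hr'dom.le.trans inf_le_right
  have hival : ∀ v, (i.toFun (T v) (T v)).re = M * ‖v‖ ^ 2 := fun v => by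
    apply le_antisymm
    · have hlim : Tendsto (fun n : ℕ => (M + 1 / ((n : ℝ) + 1)) * ‖v‖ ^ 2) atTop
          (nhds (M * ‖v‖ ^ 2)) := by
        simpa using (tendsto_one_div_add_atTop_nhds_zero_nat.const_add M).mul_const (‖v‖ ^ 2)
      refine ge_of_tendsto' hlim fun n => ?_
      obtain ⟨s, -, -, hsdom, hs⟩ := hif n
      have h1 := congrArg Complex.re (hs (T v) (T v) ⟨v, rfl⟩ ⟨v, rfl⟩)
      rw [Complex.add_re, rangeForm_apply_self] at h1
      have h2 := s.re_nonneg (T v) (hsdom.le.trans inf_le_right ⟨v, rfl⟩)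
      linarith
    · have h1 := congrArg Complex.re (hr (T v) (T v) (hTi v) (hTi v))
      rw [Complex.add_re, rangeForm_apply_self] at h1
      have h2 := r.re_nonneg (T v) (hir (hTi v))
      linarith
  refine not_closable_of_sq_functional hu hT (hDi.trans hir') (fun v => ?_) (hQ₂ _ hr'Q)
  have h1 := congrArg Complex.re (hr' (T v) (T v) (hTi v) (hTi v))
  rw [Complex.add_re, rangeForm_apply_self, hival] at h1
  linarith

/-- The generalized effect algebras `(𝓡_f(𝓗); ⊕|_{𝓡_f(𝓗)}, o)` and
`(𝓒_f(𝓗); ⊕|_{𝓒_f(𝓗)}, o)` are not monotone Dedekind downwards σ-complete: in each of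
them there is a non-increasing sequence with no infimum. -/
theorem stmt_16 [CompleteSpace H] (h_inf : ¬ FiniteDimensional ℂ H) :
    (∃ f : ℕ → PBF H, (∀ n, MemAlg PBF.Closable (f n)) ∧
      (∀ n, leQ PBF.Closable (f (n + 1)) (f n)) ∧
      ¬ ∃ i : PBF H, MemAlg PBF.Closable i ∧ (∀ n, leQ PBF.Closable i (f n)) ∧
        ∀ z : PBF H, MemAlg PBF.Closable z → (∀ n, leQ PBF.Closable z (f n)) →
          leQ PBF.Closable z i) ∧
    (∃ f : ℕ → PBF H, (∀ n, MemAlg PBF.IsClosedForm (f n)) ∧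
      (∀ n, leQ PBF.IsClosedForm (f (n + 1)) (f n)) ∧
      ¬ ∃ i : PBF H, MemAlg PBF.IsClosedForm i ∧ (∀ n, leQ PBF.IsClosedForm i (f n)) ∧
        ∀ z : PBF H, MemAlg PBF.IsClosedForm z → (∀ n, leQ PBF.IsClosedForm z (f n)) →
          leQ PBF.IsClosedForm z i) := by
  have hcl : ∀ t : PBF H, t.IsClosedForm → t.Closable := fun t ht =>
    ⟨t, ht, le_rfl, fun _ _ _ _ => rfl⟩
  exact ⟨exists_antitone_no_inf h_inf _ hcl fun _ => id,
    exists_antitone_no_inf h_inf _ (fun _ => id) hcl⟩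
end
end

section
/- Let 𝓗 be an infinite-dimensional complex Hilbert space and D ⊆ 𝓗 a dense linear subspace. Define 𝓥_{fD}(𝓗) = {t ∈ 𝓥_f(𝓗) : t is bounded, or D(t) = D}. Then 𝓥_{fD}(𝓗) is a sub-generalized effect algebra of (𝓥_f(𝓗); ⊕, o), the restricted operation ⊕|_{𝓥_{fD}(𝓗)} is a total operation, and (𝓥_{fD}(𝓗); ⊕|_{𝓥_{fD}(𝓗)}, o) is both monotone Dedekind upwards and monotone Dedekind downwards σ-complete. -/
set_option autoImplicit false

noncomputable section

open Filter

variable {H : Type*}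

variable [NormedAddCommGroup H] [InnerProductSpace ℂ H]

/-- `g` restricts to a positive sesquilinear form on the subspace `D`. -/
structure PosSesqOn (D : Submodule ℂ H) (g : H → H → ℂ) : Prop where
  add_left : ∀ x ∈ D, ∀ y ∈ D, ∀ z ∈ D, g (x + y) z = g x z + g y z
  smul_left : ∀ (c : ℂ), ∀ x ∈ D, ∀ y ∈ D, g (c • x) y = c * g x y
  add_right : ∀ x ∈ D, ∀ y ∈ D, ∀ z ∈ D, g x (y + z) = g x y + g x z
  smul_right : ∀ (c : ℂ), ∀ x ∈ D, ∀ y ∈ D, g x (c • y) = (starRingEnd ℂ) c * g x y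
  re_nonneg : ∀ x ∈ D, 0 ≤ (g x x).re
  im_zero : ∀ x ∈ D, (g x x).im = 0

namespace PosSesqOn

variable {D : Submodule ℂ H} {g : H → H → ℂ}

open Classical in
/-- The positive bilinear form with domain `D` given by `g`. -/
def toPBF (hg : PosSesqOn D g) (hD : Dense (D : Set H)) : PBF H where
  dom := D
  dense' := hD
  toFun x y := if x ∈ D ∧ y ∈ D then g x y else 0
  zero_off x y h := if_neg (by tauto)
  add_left x y z hx hy hz := by
    simp [hx, hy, hz, D.add_mem hx hy, hg.add_left x hx y hy z hz]
  smul_left c x y hx hy := by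
    simp [hx, hy, D.smul_mem c hx, hg.smul_left c x hx y hy]
  add_right x y z hx hy hz := by
    simp [hx, hy, hz, D.add_mem hy hz, hg.add_right x hx y hy z hz]
  smul_right c x y hx hy := by
    simp [hx, hy, D.smul_mem c hy, hg.smul_right c x hx y hy]
  re_nonneg x hx := by simpa [hx] using hg.re_nonneg x hx
  im_zero x hx := by simpa [hx] using hg.im_zero x hx

theorem toPBF_dom (hg : PosSesqOn D g) (hD : Dense (D : Set H)) : (hg.toPBF hD).dom = D := rfl

theorem toPBF_apply (hg : PosSesqOn D g) (hD : Dense (D : Set H)) {x y : H} (hx : x ∈ D)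
    (hy : y ∈ D) : (hg.toPBF hD).toFun x y = g x y := if_pos ⟨hx, hy⟩

theorem apply_add_smul_self (hg : PosSesqOn D g) {x y : H} (hx : x ∈ D) (hy : y ∈ D) (c : ℂ) :
    g (x + c • y) (x + c • y) =
      g x x + (starRingEnd ℂ) c * g x y + c * g y x + c * (starRingEnd ℂ) c * g y y := by
  have hc := D.smul_mem c hy
  rw [hg.add_left x hx _ hc _ (D.add_mem hx hc), hg.add_right x hx x hx _ hc,
    hg.add_right _ hc x hx _ hc, hg.smul_right c x hx y hy, hg.smul_left c y hy x hx,
    hg.smul_left c y hy _ hc, hg.smul_right c y hy y hy]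
  ring

/-- Polarization identity. -/
theorem polarization (hg : PosSesqOn D g) {x y : H} (hx : x ∈ D) (hy : y ∈ D) :
    g x y = (((g (x + y) (x + y)).re - (g (x + (-1 : ℂ) • y) (x + (-1 : ℂ) • y)).re : ℝ) +
      Complex.I * ((g (x + Complex.I • y) (x + Complex.I • y)).re -
        (g (x + (-Complex.I) • y) (x + (-Complex.I) • y)).re : ℝ)) / 4 := by
  have hre : ∀ z ∈ D, ((g z z).re : ℂ) = g z z := fun z hz =>
    Complex.ext (by simp) (by simp [hg.im_zero z hz])
  have key := hg.apply_add_smul_self hx hy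
  have hm : ∀ c : ℂ, x + c • y ∈ D := fun c => D.add_mem hx (D.smul_mem c hy)
  have h1 := key 1
  rw [one_smul] at h1
  push_cast
  rw [hre _ (D.add_mem hx hy), hre _ (hm _), hre _ (hm _), hre _ (hm _), h1, key, key, key]
  simp only [map_neg, map_one, Complex.conj_I]
  ring_nf
  simp only [Complex.I_sq]
  ring

theorem conj_symm (hg : PosSesqOn D g) {x y : H} (hx : x ∈ D) (hy : y ∈ D) :
    (starRingEnd ℂ) (g y x) = g x y := by
  have him := fun c : ℂ => hg.im_zero _ (D.add_mem hx (D.smul_mem c hy))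
  have key := hg.apply_add_smul_self hx hy
  have h1 := him 1
  have hI := him Complex.I
  rw [key] at h1 hI
  have hxx := hg.im_zero x hx
  have hyy := hg.im_zero y hy
  simp [hxx, hyy] at h1 hI
  apply Complex.ext
  · simp; linarith
  · simp; linarith

/-- Cauchy–Schwarz bound for a positive sesquilinear form with bounded diagonal. -/
theorem norm_le (hg : PosSesqOn D g) {c : ℝ} (hc : ∀ x ∈ D, (g x x).re ≤ c * ‖x‖ ^ 2)
    {x y : H} (hx : x ∈ D) (hy : y ∈ D) : ‖g x y‖ ≤ |c| * ‖x‖ * ‖y‖ := by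
  let core : PreInnerProductSpace.Core ℂ D :=
    { inner := fun a b => g b a
      conj_inner_symm := fun a b => hg.conj_symm b.2 a.2
      re_inner_nonneg := fun a => hg.re_nonneg a a.2
      add_left := fun a b z => hg.add_right z z.2 a a.2 b b.2
      smul_left := fun a b r => hg.smul_right r b b.2 a a.2 }
  have h : ‖g y x‖ * ‖g x y‖ ≤ (g x x).re * (g y y).re :=
    @InnerProductSpace.Core.inner_mul_inner_self_le ℂ D _ _ _ core ⟨x, hx⟩ ⟨y, hy⟩
  have hsymm : ‖g y x‖ = ‖g x y‖ := by rw [← hg.conj_symm hx hy, RCLike.norm_conj]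
  rw [hsymm] at h
  have hb : ∀ z ∈ D, (g z z).re ≤ |c| * ‖z‖ ^ 2 := fun z hz =>
    (hc z hz).trans (mul_le_mul_of_nonneg_right (le_abs_self c) (sq_nonneg _))
  refine nonneg_le_nonneg_of_sq_le_sq (by positivity) (h.trans ?_)
  calc (g x x).re * (g y y).re ≤ (|c| * ‖x‖ ^ 2) * (|c| * ‖y‖ ^ 2) :=
        mul_le_mul (hb x hx) (hb y hy) (hg.re_nonneg y hy) (by positivity)
    _ = _ := by ring

theorem continuous (hg : PosSesqOn D g) {c : ℝ} (hc : ∀ x ∈ D, (g x x).re ≤ c * ‖x‖ ^ 2) :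
    Continuous fun p : D × D => g p.1 p.2 := by
  have : IsBoundedBilinearMap ℝ fun p : D × D => g p.1 p.2 :=
    { add_left := fun a b z => hg.add_left a a.2 b b.2 z z.2
      smul_left := fun r a b => by simpa using hg.smul_left (r : ℂ) a a.2 b b.2
      add_right := fun z a b => hg.add_right z z.2 a a.2 b b.2
      smul_right := fun r a b => by simpa using hg.smul_right (r : ℂ) a a.2 b b.2
      bound := ⟨|c| + 1, by positivity, fun a b => (hg.norm_le hc a.2 b.2).trans (by
        have : 0 ≤ ‖(a : H)‖ * ‖(b : H)‖ := by positivity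
        simp only [Submodule.coe_norm]
        nlinarith)⟩ }
  exact this.continuous

/-- A bounded positive sesquilinear form on a dense subspace extends to the whole space. -/
theorem exists_extension (hg : PosSesqOn D g) (hD : Dense (D : Set H)) {c : ℝ}
    (hc : ∀ x ∈ D, (g x x).re ≤ c * ‖x‖ ^ 2) :
    ∃ G : H → H → ℂ, PosSesqOn ⊤ G ∧ (∀ x, (G x x).re ≤ c * ‖x‖ ^ 2) ∧
      ∀ x ∈ D, ∀ y ∈ D, G x y = g x y := by
  have hcont := hg.continuous hc
  let φ : D →+ D →+ ℂ := AddMonoidHom.mk' (fun a => AddMonoidHom.mk' (fun b => g a b)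
      (fun b b' => hg.add_right a a.2 b b.2 b' b'.2))
    (fun a a' => AddMonoidHom.ext fun b => hg.add_left a a.2 a' a'.2 b b.2)
  have di : IsDenseInducing (D.subtype.toAddMonoidHom : D → H) := hD.isDenseInducing_val
  have hφ : Continuous fun p : D × D => φ p.1 p.2 := hcont
  have hG := di.extend_Z_bilin di hφ
  set F := (di.prodMap di).extend fun p : D × D => φ p.1 p.2
  have hFg : ∀ x ∈ D, ∀ y ∈ D, F (x, y) = g x y := fun x hx y hy =>
    (di.prodMap di).extend_eq hφ (⟨x, hx⟩, ⟨y, hy⟩)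
  have h2 := hD.prod hD
  have h3 := hD.prod h2
  refine ⟨fun x y => F (x, y), ⟨?_, ?_, ?_, ?_, ?_, ?_⟩, ?_, hFg⟩
  · intro x _ y _ z _
    refine congrFun (Continuous.ext_on h3 (f := fun p : H × H × H => F (p.1 + p.2.1, p.2.2))
      (g := fun p : H × H × H => F (p.1, p.2.2) + F (p.2.1, p.2.2))
      (by fun_prop) (by fun_prop) ?_) (x, y, z)
    rintro ⟨x, y, z⟩ ⟨hx, hy, hz⟩
    simp only [hFg _ (D.add_mem hx hy) _ hz, hFg _ hx _ hz, hFg _ hy _ hz,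
      hg.add_left _ hx _ hy _ hz]
  · intro r x _ y _
    refine congrFun (Continuous.ext_on h2 (f := fun p : H × H => F (r • p.1, p.2))
      (g := fun p : H × H => r * F (p.1, p.2)) (by fun_prop) (by fun_prop) ?_) (x, y)
    rintro ⟨x, y⟩ ⟨hx, hy⟩
    simp only [hFg _ (D.smul_mem r hx) _ hy, hFg _ hx _ hy, hg.smul_left r _ hx _ hy]
  · intro x _ y _ z _
    refine congrFun (Continuous.ext_on h3 (f := fun p : H × H × H => F (p.1, p.2.1 + p.2.2))
      (g := fun p : H × H × H => F (p.1, p.2.1) + F (p.1, p.2.2))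
      (by fun_prop) (by fun_prop) ?_) (x, y, z)
    rintro ⟨x, y, z⟩ ⟨hx, hy, hz⟩
    simp only [hFg _ hx _ (D.add_mem hy hz), hFg _ hx _ hz, hFg _ hx _ hy,
      hg.add_right _ hx _ hy _ hz]
  · intro r x _ y _
    refine congrFun (Continuous.ext_on h2 (f := fun p : H × H => F (p.1, r • p.2))
      (g := fun p : H × H => (starRingEnd ℂ) r * F (p.1, p.2)) (by fun_prop) (by fun_prop) ?_)
      (x, y)
    rintro ⟨x, y⟩ ⟨hx, hy⟩
    simp only [hFg _ hx _ (D.smul_mem r hy), hFg _ hx _ hy, hg.smul_right r _ hx _ hy]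
  · intro x _
    refine hD.induction (P := fun x => 0 ≤ (F (x, x)).re) (fun x hx => ?_)
      (isClosed_le continuous_const (Complex.continuous_re.comp (by fun_prop))) x
    rw [hFg x hx x hx]
    exact hg.re_nonneg x hx
  · intro x _
    refine hD.induction (P := fun x => (F (x, x)).im = 0) (fun x hx => ?_)
      (isClosed_eq (Complex.continuous_im.comp (by fun_prop)) continuous_const) x
    rw [hFg x hx x hx]
    exact hg.im_zero x hx
  · intro x
    refine hD.induction (P := fun x => (F (x, x)).re ≤ c * ‖x‖ ^ 2) (fun x hx => ?_)
      (isClosed_le (Complex.continuous_re.comp (by fun_prop)) (by fun_prop)) x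
    rw [hFg x hx x hx]
    exact hc x hx

theorem add {g' : H → H → ℂ} (hg : PosSesqOn D g) (hg' : PosSesqOn D g') :
    PosSesqOn D fun x y => g x y + g' x y where
  add_left x hx y hy z hz := by
    simp only [hg.add_left x hx y hy z hz, hg'.add_left x hx y hy z hz]; ring
  smul_left c x hx y hy := by simp only [hg.smul_left c x hx y hy, hg'.smul_left c x hx y hy]; ring
  add_right x hx y hy z hz := by
    simp only [hg.add_right x hx y hy z hz, hg'.add_right x hx y hy z hz]; ring
  smul_right c x hx y hy := by
    simp only [hg.smul_right c x hx y hy, hg'.smul_right c x hx y hy]; ring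
  re_nonneg x hx := by simpa using add_nonneg (hg.re_nonneg x hx) (hg'.re_nonneg x hx)
  im_zero x hx := by simp [hg.im_zero x hx, hg'.im_zero x hx]

theorem sub {g' : H → H → ℂ} (hg : PosSesqOn D g) (hg' : PosSesqOn D g')
    (hle : ∀ x ∈ D, (g' x x).re ≤ (g x x).re) : PosSesqOn D fun x y => g x y - g' x y where
  add_left x hx y hy z hz := by
    simp only [hg.add_left x hx y hy z hz, hg'.add_left x hx y hy z hz]; ring
  smul_left c x hx y hy := by simp only [hg.smul_left c x hx y hy, hg'.smul_left c x hx y hy]; ring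
  add_right x hx y hy z hz := by
    simp only [hg.add_right x hx y hy z hz, hg'.add_right x hx y hy z hz]; ring
  smul_right c x hx y hy := by
    simp only [hg.smul_right c x hx y hy, hg'.smul_right c x hx y hy]; ring
  re_nonneg x hx := by simpa using hle x hx
  im_zero x hx := by simp [hg.im_zero x hx, hg'.im_zero x hx]

/-- A sequence of positive sesquilinear forms whose diagonals converge has a pointwise limit,
which is again a positive sesquilinear form. -/
theorem exists_limit {f : ℕ → H → H → ℂ} (hf : ∀ n, PosSesqOn D (f n))
    (hlim : ∀ x ∈ D, ∃ l : ℝ, Tendsto (fun n => (f n x x).re) atTop (nhds l)) :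
    ∃ G : H → H → ℂ, PosSesqOn D G ∧
      ∀ x ∈ D, ∀ y ∈ D, Tendsto (fun n => f n x y) atTop (nhds (G x y)) := by
  have hconv : ∀ x y, ∃ l : ℂ, x ∈ D → y ∈ D → Tendsto (fun n => f n x y) atTop (nhds l) := by
    intro x y
    by_cases h : x ∈ D ∧ y ∈ D
    · obtain ⟨hx, hy⟩ := h
      have hm : ∀ c : ℂ, x + c • y ∈ D := fun c => D.add_mem hx (D.smul_mem c hy)
      obtain ⟨a, ha⟩ := hlim _ (D.add_mem hx hy)
      obtain ⟨b, hb⟩ := hlim _ (hm (-1))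
      obtain ⟨c, hc⟩ := hlim _ (hm Complex.I)
      obtain ⟨d, hd⟩ := hlim _ (hm (-Complex.I))
      refine ⟨((a - b : ℝ) + Complex.I * (c - d : ℝ)) / 4, fun _ _ => ?_⟩
      simp only [fun n => (hf n).polarization hx hy]
      exact (((Complex.continuous_ofReal.tendsto _).comp (ha.sub hb)).add
        (((Complex.continuous_ofReal.tendsto _).comp (hc.sub hd)).const_mul _)).div_const 4
    · exact ⟨0, fun hx hy => absurd ⟨hx, hy⟩ h⟩
  choose G hG using hconv
  refine ⟨G, ⟨?_, ?_, ?_, ?_, ?_, ?_⟩, fun x hx y hy => hG x y hx hy⟩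
  · intro x hx y hy z hz
    refine tendsto_nhds_unique (hG _ _ (D.add_mem hx hy) hz) ?_
    simpa only [fun n => (hf n).add_left x hx y hy z hz] using (hG x z hx hz).add (hG y z hy hz)
  · intro c x hx y hy
    refine tendsto_nhds_unique (hG _ _ (D.smul_mem c hx) hy) ?_
    simpa only [fun n => (hf n).smul_left c x hx y hy] using (hG x y hx hy).const_mul c
  · intro x hx y hy z hz
    refine tendsto_nhds_unique (hG _ _ hx (D.add_mem hy hz)) ?_
    simpa only [fun n => (hf n).add_right x hx y hy z hz] using (hG x y hx hy).add (hG x z hx hz)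
  · intro c x hx y hy
    refine tendsto_nhds_unique (hG _ _ hx (D.smul_mem c hy)) ?_
    simpa only [fun n => (hf n).smul_right c x hx y hy] using (hG x y hx hy).const_mul _
  · intro x hx
    exact ge_of_tendsto' ((Complex.continuous_re.tendsto _).comp (hG x x hx hx))
      fun n => (hf n).re_nonneg x hx
  · intro x hx
    refine tendsto_nhds_unique ((Complex.continuous_im.tendsto _).comp (hG x x hx hx)) ?_
    simp only [Function.comp_def, fun n => (hf n).im_zero x hx, tendsto_const_nhds]

end PosSesqOn

namespace PBF

theorem posSesqOn (t : PBF H) {D : Submodule ℂ H} (h : D ≤ t.dom) : PosSesqOn D t.toFun where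
  add_left x hx y hy z hz := t.add_left x y z (h hx) (h hy) (h hz)
  smul_left c x hx y hy := t.smul_left c x y (h hx) (h hy)
  add_right x hx y hy z hz := t.add_right x y z (h hx) (h hy) (h hz)
  smul_right c x hx y hy := t.smul_right c x y (h hx) (h hy)
  re_nonneg x hx := t.re_nonneg x (h hx)
  im_zero x hx := t.im_zero x (h hx)

theorem continuous_of_bounded {t : PBF H} (hb : t.Bounded) (ht : t.dom = ⊤) :
    Continuous fun p : H × H => t.toFun p.1 p.2 := by
  obtain ⟨c, hc⟩ := hb
  have hmem : ∀ x, x ∈ t.dom := fun x => ht ▸ Submodule.mem_top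
  have h := (t.posSesqOn le_rfl).continuous hc
  have hι : Continuous fun x : H => (⟨x, hmem x⟩ : t.dom) := by fun_prop
  exact h.comp (f := fun p : H × H => ((⟨p.1, hmem p.1⟩ : t.dom), (⟨p.2, hmem p.2⟩ : t.dom)))
    ((hι.comp continuous_fst).prodMk (hι.comp continuous_snd))

/-- A summand of a bounded form is bounded on the domain of the sum. -/
theorem IsSum.bounded_left {x y z : PBF H} (h : IsSum x y z) (hz : z.Bounded)
    (hd : x.dom ≤ z.dom) : x.Bounded := by
  obtain ⟨c, hc⟩ := hz
  refine ⟨c, fun v hv => ?_⟩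
  have hv' := hd hv
  have h1 := hc v hv'
  rw [h.2 v v hv' hv', Complex.add_re] at h1
  have := y.re_nonneg v (h.1 ▸ hv' : v ∈ x.dom ⊓ y.dom).2
  linarith

theorem IsSum.symm {x y z : PBF H} (h : IsSum x y z) : IsSum y x z :=
  ⟨h.1.trans (inf_comm _ _), fun a b ha hb => (h.2 a b ha hb).trans (add_comm _ _)⟩

theorem IsSum.bounded {x y z : PBF H} (h : IsSum x y z) (hx : x.Bounded) (hy : y.Bounded) :
    z.Bounded := by
  obtain ⟨c, hc⟩ := hx
  obtain ⟨d, hd⟩ := hy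
  refine ⟨c + d, fun v hv => ?_⟩
  have hv' : v ∈ x.dom ⊓ y.dom := h.1 ▸ hv
  rw [h.2 v v hv hv, Complex.add_re, add_mul]
  exact add_le_add (hc v hv'.1) (hd v hv'.2)

end PBF

/-- Membership in the algebra of forms that are bounded or have domain `D`. -/
abbrev MemD (D : Submodule ℂ H) (t : PBF H) : Prop :=
  MemAlg (fun u : PBF H => u.Bounded ∨ u.dom = D) t

namespace MemD

variable {D : Submodule ℂ H} {t s r : PBF H}

theorem le_dom (h : MemD D t) : D ≤ t.dom := by
  rcases h.2 with hb | hd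
  · rw [h.1 hb]; exact le_top
  · exact hd.ge

theorem bounded_of_le (h : MemD D t) {c : ℝ}
    (hc : ∀ x ∈ D, (t.toFun x x).re ≤ c * ‖x‖ ^ 2) : t.Bounded := by
  rcases h.2 with hb | hd
  · exact hb
  · exact ⟨c, hd ▸ hc⟩

theorem bounded_mono (ht : MemD D t) (hs : MemD D s) (hb : t.Bounded)
    (hle : ∀ x ∈ D, (s.toFun x x).re ≤ (t.toFun x x).re) : s.Bounded := by
  obtain ⟨c, hc⟩ := hb
  exact hs.bounded_of_le fun x hx => (hle x hx).trans (hc x (ht.le_dom hx))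

/-- The addition of the algebra is determined by the values on `D`. -/
theorem oplus_of_eqOn (ht : MemD D t) (hs : MemD D s) (hr : MemD D r) (hD : Dense (D : Set H))
    (h : ∀ x ∈ D, ∀ y ∈ D, t.toFun x y = s.toFun x y + r.toFun x y) : PBF.Oplus s r t := by
  have hst : ∀ x ∈ D, (s.toFun x x).re ≤ (t.toFun x x).re := fun x hx => by
    rw [h x hx x hx, Complex.add_re]
    linarith [r.re_nonneg x (hr.le_dom hx)]
  have hrt : ∀ x ∈ D, (r.toFun x x).re ≤ (t.toFun x x).re := fun x hx => by
    rw [h x hx x hx, Complex.add_re]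
    linarith [s.re_nonneg x (hs.le_dom hx)]
  by_cases hb : s.Bounded ∧ r.Bounded
  · obtain ⟨hsb, hrb⟩ := hb
    have hsd := hs.1 hsb
    have hrd := hr.1 hrb
    have htb : t.Bounded := by
      obtain ⟨c, hc⟩ := hsb
      obtain ⟨d, hd⟩ := hrb
      refine ht.bounded_of_le (c := c + d) fun x hx => ?_
      rw [h x hx x hx, Complex.add_re, add_mul]
      exact add_le_add (hc x (hs.le_dom hx)) (hd x (hr.le_dom hx))
    have htd := ht.1 htb
    refine ⟨Or.inl hsb, by rw [htd, hsd, hrd, inf_top_eq], fun x y _ _ => ?_⟩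
    exact congrFun (Continuous.ext_on (hD.prod hD) (PBF.continuous_of_bounded htb htd)
      ((PBF.continuous_of_bounded hsb hsd).add (PBF.continuous_of_bounded hrb hrd))
      fun p hp => h p.1 hp.1 p.2 hp.2) (x, y)
  · have htb : ¬ t.Bounded := fun htb =>
      hb ⟨bounded_mono ht hs htb hst, bounded_mono ht hr htb hrt⟩
    have htd : t.dom = D := ht.2.resolve_left htb
    refine ⟨?_, ?_, fun x y hx hy => h x (htd ▸ hx) y (htd ▸ hy)⟩
    · rcases hs.2 with h1 | h1
      · exact Or.inl h1
      rcases hr.2 with h2 | h2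
      · exact Or.inr (Or.inl h2)
      · exact Or.inr (Or.inr (h1.trans h2.symm))
    · rw [htd]
      refine le_antisymm (le_inf hs.le_dom hr.le_dom) ?_
      by_cases hsb : s.Bounded
      · exact inf_le_right.trans (hr.2.resolve_left fun hrb => hb ⟨hsb, hrb⟩).le
      · exact inf_le_left.trans (hs.2.resolve_left hsb).le

end MemD

/-- Every positive sesquilinear form on `D` is the restriction of an element of the algebra. -/
theorem PosSesqOn.exists_memD {D : Submodule ℂ H} {g : H → H → ℂ} (hg : PosSesqOn D g)
    (hD : Dense (D : Set H)) :
    ∃ t : PBF H, MemD D t ∧ ∀ x ∈ D, ∀ y ∈ D, t.toFun x y = g x y := by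
  by_cases hb : ∃ c : ℝ, ∀ x ∈ D, (g x x).re ≤ c * ‖x‖ ^ 2
  · obtain ⟨c, hc⟩ := hb
    obtain ⟨G, hG, hGc, hGg⟩ := hg.exists_extension hD hc
    have hT : Dense ((⊤ : Submodule ℂ H) : Set H) := dense_univ
    have hval : ∀ x y, (hG.toPBF hT).toFun x y = G x y := fun x y =>
      hG.toPBF_apply hT Submodule.mem_top Submodule.mem_top
    refine ⟨hG.toPBF hT, ⟨fun _ => rfl, Or.inl ⟨c, fun x _ => ?_⟩⟩, fun x hx y hy => ?_⟩
    · rw [hval]; exact hGc x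
    · rw [hval]; exact hGg x hx y hy
  · refine ⟨hg.toPBF hD, ⟨fun ⟨c, hc⟩ => absurd ⟨c, fun x hx => ?_⟩ hb, Or.inr rfl⟩,
      fun x hx y hy => hg.toPBF_apply hD hx hy⟩
    simpa only [hg.toPBF_apply hD hx hx] using hc x hx

/-- The order of the algebra is the pointwise order of quadratic forms on `D`. -/
theorem leQ_iff {D : Submodule ℂ H} (hD : Dense (D : Set H)) {s t : PBF H} (hs : MemD D s)
    (ht : MemD D t) : leQ (fun u : PBF H => u.Bounded ∨ u.dom = D) s t ↔
      ∀ x ∈ D, (s.toFun x x).re ≤ (t.toFun x x).re := by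
  constructor
  · rintro ⟨r, hr, _, _, hsum⟩ x hx
    rw [hsum x x (ht.le_dom hx) (ht.le_dom hx), Complex.add_re]
    linarith [r.re_nonneg x (MemD.le_dom hr hx)]
  · intro hle
    obtain ⟨r, hr, hrg⟩ :=
      ((t.posSesqOn ht.le_dom).sub (s.posSesqOn hs.le_dom) hle).exists_memD hD
    refine ⟨r, hr, MemD.oplus_of_eqOn ht hs hr hD fun x hx y hy => ?_⟩
    rw [hrg x hx y hy]
    ring

theorem subGEACond_boundedOrDom (D : Submodule ℂ H) :
    SubGEACond (fun t : PBF H => t.Bounded ∨ t.dom = D) := by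
  have key : ∀ x y z : PBF H, x.InVf → z.InVf → PBF.Oplus x y z →
      (x.Bounded ∨ x.dom = D) → (z.Bounded ∨ z.dom = D) → (y.Bounded ∨ y.dom = D) := by
    intro x y z hx hz ⟨hdef, hsum⟩ hxQ hzQ
    by_cases hzb : z.Bounded
    · exact Or.inl (hsum.symm.bounded_left hzb (hz hzb ▸ le_top))
    · have hzd := hzQ.resolve_left hzb
      by_cases hxb : x.Bounded
      · right
        rw [← hzd, hsum.1, hx hxb, top_inf_eq]
      · rcases hdef with h | h | h
        · exact absurd h hxb
        · exact Or.inl h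
        · exact Or.inr (h ▸ hxQ.resolve_left hxb)
  refine ⟨Or.inl ⟨0, fun x _ => by simp [zeroPBF]⟩, ?_⟩
  intro x y z hx hy hz hxyz h
  have hyxz : PBF.Oplus y x z :=
    ⟨by have := hxyz.1; unfold PBF.OplusDef at *; tauto, hxyz.2.symm⟩
  rcases h with ⟨h1, h2⟩ | ⟨h1, h2⟩ | ⟨h1, h2⟩
  · refine ⟨h1, h2, ?_⟩
    by_cases hxb : x.Bounded
    · by_cases hyb : y.Bounded
      · exact Or.inl (hxyz.2.bounded hxb hyb)
      · right
        rw [hxyz.2.1, hx hxb, top_inf_eq, h2.resolve_left hyb]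
    · right
      have hxd := h1.resolve_left hxb
      rw [hxyz.2.1, hxd]
      rcases h2 with hyb | hyd
      · rw [hy hyb, inf_top_eq]
      · rw [hyd, inf_idem]
  · exact ⟨h1, key x y z hx hz hxyz h1 h2, h2⟩
  · exact ⟨key y x z hy hz hyxz h1 h2, h1, h2⟩

theorem exists_oplus {D : Submodule ℂ H} (hD : Dense (D : Set H)) {t s : PBF H} (ht : MemD D t)
    (hs : MemD D s) : ∃ w : PBF H, MemD D w ∧ PBF.Oplus t s w := by
  obtain ⟨w, hw, hwg⟩ := ((t.posSesqOn ht.le_dom).add (s.posSesqOn hs.le_dom)).exists_memD hD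
  exact ⟨w, hw, MemD.oplus_of_eqOn hw ht hs hD hwg⟩

/-- A sequence in the algebra whose diagonals converge on `D` has a limit in the algebra. -/
theorem exists_memD_tendsto {D : Submodule ℂ H} (hD : Dense (D : Set H)) {f : ℕ → PBF H}
    (hf : ∀ n, MemD D (f n))
    (hlim : ∀ x ∈ D, ∃ l : ℝ, Tendsto (fun n => ((f n).toFun x x).re) atTop (nhds l)) :
    ∃ t : PBF H, MemD D t ∧
      ∀ x ∈ D, Tendsto (fun n => ((f n).toFun x x).re) atTop (nhds (t.toFun x x).re) := by
  obtain ⟨G, hG, hGlim⟩ :=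
    PosSesqOn.exists_limit (fun n => (f n).posSesqOn (hf n).le_dom) hlim
  obtain ⟨t, ht, htG⟩ := hG.exists_memD hD
  refine ⟨t, ht, fun x hx => ?_⟩
  rw [htG x hx x hx]
  exact (Complex.continuous_re.tendsto _).comp (hGlim x hx x hx)

theorem upSigmaQ_boundedOrDom {D : Submodule ℂ H} (hD : Dense (D : Set H)) :
    UpSigmaQ (fun u : PBF H => u.Bounded ∨ u.dom = D) := by
  rintro f hf hmono ⟨b, hb, hfb⟩
  have hm : ∀ x ∈ D, Monotone fun n => ((f n).toFun x x).re := fun x hx =>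
    monotone_nat_of_le_succ fun n => (leQ_iff hD (hf n) (hf (n + 1))).1 (hmono n) x hx
  obtain ⟨s, hs, hlim⟩ := exists_memD_tendsto hD hf fun x hx =>
    ⟨_, tendsto_atTop_ciSup (hm x hx) ⟨(b.toFun x x).re,
      Set.forall_mem_range.2 fun n => (leQ_iff hD (hf n) hb).1 (hfb n) x hx⟩⟩
  refine ⟨s, hs, fun n => (leQ_iff hD (hf n) hs).2 fun x hx =>
      (hm x hx).ge_of_tendsto (hlim x hx) n,
    fun z hz hfz => (leQ_iff hD hs hz).2 fun x hx => ?_⟩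
  exact le_of_tendsto' (hlim x hx) fun n => (leQ_iff hD (hf n) hz).1 (hfz n) x hx

theorem downSigmaQ_boundedOrDom {D : Submodule ℂ H} (hD : Dense (D : Set H)) :
    DownSigmaQ (fun u : PBF H => u.Bounded ∨ u.dom = D) := by
  intro f hf hanti
  have hm : ∀ x ∈ D, Antitone fun n => ((f n).toFun x x).re := fun x hx =>
    antitone_nat_of_succ_le fun n => (leQ_iff hD (hf (n + 1)) (hf n)).1 (hanti n) x hx
  obtain ⟨i, hi, hlim⟩ := exists_memD_tendsto hD hf fun x hx =>
    ⟨_, tendsto_atTop_ciInf (hm x hx) ⟨0,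
      Set.forall_mem_range.2 fun n => (f n).re_nonneg x (MemD.le_dom (hf n) hx)⟩⟩
  refine ⟨i, hi, fun n => (leQ_iff hD hi (hf n)).2 fun x hx =>
      (hm x hx).le_of_tendsto (hlim x hx) n,
    fun z hz hzf => (leQ_iff hD hz hi).2 fun x hx => ?_⟩
  exact ge_of_tendsto' (hlim x hx) fun n => (leQ_iff hD hz (hf n)).1 (hzf n) x hx

/-- For a dense linear subspace `D ⊆ 𝓗`, the set
`𝓥_{fD}(𝓗) = {t ∈ 𝓥_f(𝓗) : t is bounded, or D(t) = D}` is a sub-generalized effect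
algebra of `(𝓥_f(𝓗); ⊕, o)`, the restricted operation is total, and
`(𝓥_{fD}(𝓗); ⊕|_{𝓥_{fD}(𝓗)}, o)` is monotone Dedekind upwards and downwards
σ-complete. -/
theorem stmt_17 [CompleteSpace H] (h_inf : ¬ FiniteDimensional ℂ H)
    (D : Submodule ℂ H) (hD : Dense (D : Set H)) :
    SubGEACond (fun t : PBF H => t.Bounded ∨ t.dom = D) ∧
    -- the restricted operation is total
    (∀ t s : PBF H, MemAlg (fun u : PBF H => u.Bounded ∨ u.dom = D) t →
      MemAlg (fun u : PBF H => u.Bounded ∨ u.dom = D) s →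
      ∃ w : PBF H, MemAlg (fun u : PBF H => u.Bounded ∨ u.dom = D) w ∧ PBF.Oplus t s w) ∧
    UpSigmaQ (fun u : PBF H => u.Bounded ∨ u.dom = D) ∧
    DownSigmaQ (fun u : PBF H => u.Bounded ∨ u.dom = D) := by
  exact ⟨subGEACond_boundedOrDom D, fun t s ht hs => exists_oplus hD ht hs,
    upSigmaQ_boundedOrDom hD, downSigmaQ_boundedOrDom hD⟩
end
end

section
/- Let 𝓗 be an infinite-dimensional complex Hilbert space. Then the generalized effect algebra (𝓥_f(𝓗); ⊕̄, o) is not monotone Dedekind downwards σ-complete: there exists a non-increasing sequence in 𝓥_f(𝓗) (with respect to the order induced by ⊕̄) that has no infimum. -/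
set_option autoImplicit false

noncomputable section

open Filter

variable {H : Type*}

variable [NormedAddCommGroup H] [InnerProductSpace ℂ H]

/-- Definedness of the restricted operation `⊕̄` on `𝓥_f(𝓗)`: `t ⊕̄ s` is defined iff
`t ⊕ s` is defined and `(t+s)_r = t_r + s_r` (the regular parts add up). -/
def ObarDef (t s : PBF H) : Prop :=
  PBF.OplusDef t s ∧
  ∀ u tr sr ur : PBF H, PBF.IsSum t s u →
    t.IsRegularPart tr → s.IsRegularPart sr → u.IsRegularPart ur →
    PBF.IsSum tr sr ur

/-- `t ⊕̄ s = u`. -/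
def Obar (t s u : PBF H) : Prop := ObarDef t s ∧ PBF.IsSum t s u

/-- The order induced by `⊕̄` on `𝓥_f(𝓗)`. -/
def leBar (s t : PBF H) : Prop := ∃ r : PBF H, r.InVf ∧ Obar s r t

namespace PBF

theorem isSum_unique {t s u u' : PBF H} (h : IsSum t s u) (h' : IsSum t s u') : u = u' := by
  have hdom : u.dom = u'.dom := h.1.trans h'.1.symm
  have hfun : u.toFun = u'.toFun := by
    funext x y
    by_cases hxy : x ∈ u.dom ∧ y ∈ u.dom
    · rw [h.2 x y hxy.1 hxy.2, h'.2 x y (hdom ▸ hxy.1) (hdom ▸ hxy.2)]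
    · rw [not_and_or] at hxy
      rw [u.zero_off x y hxy, u'.zero_off x y (hdom ▸ hxy)]
  cases u
  cases u'
  simp only at hdom hfun
  subst hdom hfun
  rfl

/-- Polarization. -/
theorem toFun_eq_of_diag {t s : PBF H} (hdom : s.dom = t.dom)
    (h : ∀ x ∈ t.dom, (s.toFun x x).re = (t.toFun x x).re) (x y : H) :
    s.toFun x y = t.toFun x y := by
  by_cases hxy : x ∈ t.dom ∧ y ∈ t.dom
  swap
  · rw [not_and_or] at hxy
    rw [t.zero_off x y hxy, s.zero_off x y (hdom ▸ hxy)]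
  obtain ⟨hx, hy⟩ := hxy
  have diag : ∀ z ∈ t.dom, s.toFun z z = t.toFun z z := fun z hz =>
    Complex.ext (h z hz) (by rw [t.im_zero z hz, s.im_zero z (hdom ▸ hz)])
  have expand : ∀ (r : PBF H) (c : ℂ), x ∈ r.dom → y ∈ r.dom →
      r.toFun (x + c • y) (x + c • y) = r.toFun x x + starRingEnd ℂ c * r.toFun x y +
        (c * r.toFun y x + c * (starRingEnd ℂ c * r.toFun y y)) := by
    intro r c hx hy
    have hc := r.dom.smul_mem c hy
    rw [r.add_left _ _ _ hx hc (r.dom.add_mem hx hc), r.add_right _ _ _ hx hx hc,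
      r.add_right _ _ _ hc hx hc, r.smul_right _ _ _ hx hy, r.smul_right _ _ _ hc hy,
      r.smul_left _ _ _ hy hx, r.smul_left _ _ _ hy hy]
    ring
  have hx' : x ∈ s.dom := hdom ▸ hx
  have hy' : y ∈ s.dom := hdom ▸ hy
  have h1 := diag _ (t.dom.add_mem hx (t.dom.smul_mem 1 hy))
  have hI := diag _ (t.dom.add_mem hx (t.dom.smul_mem Complex.I hy))
  rw [expand s _ hx' hy', expand t _ hx hy, diag x hx, diag y hy] at h1 hI
  simp only [map_one, one_mul, Complex.conj_I] at h1 hI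
  have hII := Complex.I_mul_I
  linear_combination (1 / 2) * h1 + (Complex.I / 2) * hI +
    (1 / 2) * (s.toFun x y - t.toFun x y - s.toFun y x + t.toFun y x) * hII

theorem diag_add_le (t : PBF H) {x y : H} (hx : x ∈ t.dom) (hy : y ∈ t.dom) {ε : ℝ}
    (hε : 0 < ε) :
    (t.toFun (x + y) (x + y)).re ≤
      (1 + ε) * (t.toFun x x).re + (1 + ε⁻¹) * (t.toFun y y).re := by
  have hs := t.dom.smul_mem (-ε : ℂ) hx
  have h := t.re_nonneg _ (t.dom.add_mem hs hy)
  rw [t.add_left _ _ _ hs hy (t.dom.add_mem hs hy), t.add_right _ _ _ hs hs hy,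
    t.add_right _ _ _ hy hs hy, t.smul_left _ _ _ hx hs, t.smul_left _ _ _ hx hy,
    t.smul_right _ _ _ hx hx, t.smul_right _ _ _ hy hx] at h
  rw [t.add_left _ _ _ hx hy (t.dom.add_mem hx hy), t.add_right _ _ _ hx hx hy,
    t.add_right _ _ _ hy hx hy]
  have e1 : (starRingEnd ℂ) (-(ε : ℂ)) = ((-ε : ℝ) : ℂ) := by
    simp
  have e2 : (-(ε : ℂ)) = ((-ε : ℝ) : ℂ) := by simp
  rw [e1, e2] at h
  simp only [Complex.add_re, Complex.re_ofReal_mul] at h ⊢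
  have h2 := mul_nonneg (inv_nonneg.2 hε.le) h
  have h3 : ε⁻¹ * ε = 1 := inv_mul_cancel₀ hε.ne'
  have h4 : ε⁻¹ * (-ε * (-ε * (t.toFun x x).re) + -ε * (t.toFun x y).re +
      (-ε * (t.toFun y x).re + (t.toFun y y).re)) = ε * (t.toFun x x).re -
      (t.toFun x y).re - (t.toFun y x).re + ε⁻¹ * (t.toFun y y).re := by
    linear_combination (ε * (t.toFun x x).re - (t.toFun x y).re - (t.toFun y x).re) * h3
  linarith

theorem Extends.q_eq {s t : PBF H} (h : s.Extends t) {x : H} (hx : x ∈ t.dom) :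
    s.q x = t.q x := by
  rw [q, q, h.2 x x hx hx]

theorem Closable.tendsto_diag_zero {t : PBF H} (ht : t.Closable) {z : ℕ → H}
    (hz : ∀ k, z k ∈ t.dom) (hz0 : Tendsto z atTop (nhds 0))
    (hzz : ∀ k l, (t.toFun (z k - z l) (z k - z l)).re ≤ 0) :
    Tendsto (fun k => (t.toFun (z k) (z k)).re) atTop (nhds 0) := by
  obtain ⟨s, hs, hst⟩ := ht
  obtain ⟨y, hy, hlim⟩ := hs z (fun k => hst.1 (hz k)) (by
    intro ε hε
    obtain ⟨N, hN⟩ := Metric.cauchySeq_iff.1 hz0.cauchySeq (√ε) (Real.sqrt_pos.2 hε)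
    refine ⟨N, fun m hm n hn => ?_⟩
    have h1 := hN m hm n hn
    rw [dist_eq_norm] at h1
    rw [hst.q_eq (t.dom.sub_mem (hz m) (hz n)), q]
    have h2 : ‖z m - z n‖ ^ 2 < ε := by
      rw [← Real.sq_sqrt hε.le]
      gcongr
    linarith [hzz m n])
  have hnorm : Tendsto (fun k => ‖z k - y‖ ^ 2) atTop (nhds 0) :=
    squeeze_zero (fun k => by positivity)
      (fun k => le_add_of_nonneg_left (s.re_nonneg _ (s.dom.sub_mem (hst.1 (hz k)) hy))) hlim
  have hnorm' : Tendsto (fun k => ‖z k - y‖ ^ 2) atTop (nhds (‖0 - y‖ ^ 2)) :=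
    ((hz0.sub_const y).norm).pow 2
  have hy0 : y = 0 := by
    have := tendsto_nhds_unique hnorm' hnorm
    simpa using this
  subst hy0
  refine squeeze_zero (fun k => t.re_nonneg _ (hz k)) (fun k => ?_) hlim
  rw [sub_zero, hst.q_eq (hz k), q]
  exact le_add_of_nonneg_right (by positivity)

theorem Closable.isRegularPart_self {t : PBF H} (ht : t.Closable) : t.IsRegularPart t :=
  ⟨ht, rfl, fun _ _ => le_rfl, fun _ _ _ h => h⟩

theorem IsRegularPart.toFun_eq {t r r' : PBF H} (h : t.IsRegularPart r)
    (h' : t.IsRegularPart r') (x y : H) : r.toFun x y = r'.toFun x y :=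
  toFun_eq_of_diag (h.2.1.trans h'.2.1.symm) (fun x hx => le_antisymm
    (h'.2.2.2 r h.1 h.2.1 h.2.2.1 x (h'.2.1 ▸ hx))
    (h.2.2.2 r' h'.1 h'.2.1 h'.2.2.1 x (h'.2.1 ▸ hx))) x y

/-- A closable form below `t` is its regular part as soon as it is approximately attained by `t`
along null sequences that are constant for `t`. -/
theorem isRegularPart_of_null_sequences {t g : PBF H} (hg : g.Closable) (hdom : g.dom = t.dom)
    (hle : ∀ x ∈ t.dom, (g.toFun x x).re ≤ (t.toFun x x).re)
    (hseq : ∀ x ∈ t.dom, ∃ z : ℕ → H, (∀ k, z k ∈ t.dom) ∧ Tendsto z atTop (nhds 0) ∧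
      (∀ k l, (t.toFun (z k - z l) (z k - z l)).re ≤ 0) ∧
      ∀ k, (t.toFun (x - z k) (x - z k)).re ≤ (g.toFun x x).re) :
    t.IsRegularPart g := by
  refine ⟨hg, hdom, hle, fun r hr hrdom hrle x hx => ?_⟩
  obtain ⟨z, hz, hz0, hzz, hxz⟩ := hseq x hx
  have hlim := hr.tendsto_diag_zero (fun k => hrdom ▸ hz k) hz0
    fun k l => (hrle _ (t.dom.sub_mem (hz k) (hz l))).trans (hzz k l)
  have hε : ∀ ε : ℝ, 0 < ε → (r.toFun x x).re ≤ (1 + ε) * (g.toFun x x).re := by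
    intro ε hε
    have h1 : Tendsto (fun k => (1 + ε) * (g.toFun x x).re +
        (1 + ε⁻¹) * (r.toFun (z k) (z k)).re) atTop
        (nhds ((1 + ε) * (g.toFun x x).re + (1 + ε⁻¹) * 0)) :=
      tendsto_const_nhds.add (hlim.const_mul _)
    rw [mul_zero, add_zero] at h1
    refine ge_of_tendsto' h1 fun k => ?_
    have hxk := t.dom.sub_mem hx (hz k)
    have h2 := r.diag_add_le (x := x - z k) (y := z k) (hrdom ▸ hxk) (hrdom ▸ hz k) hε
    rw [sub_add_cancel] at h2
    have h3 := (hrle _ hxk).trans (hxz k)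
    have h4 : (1 + ε) * (r.toFun (x - z k) (x - z k)).re ≤ (1 + ε) * (g.toFun x x).re := by
      gcongr
    linarith
  have h5 : Tendsto (fun ε : ℝ => (1 + ε) * (g.toFun x x).re) (nhdsWithin 0 (Set.Ioi 0))
      (nhds ((1 + 0) * (g.toFun x x).re)) := by
    refine Tendsto.mono_left (Continuous.tendsto ?_ 0) nhdsWithin_le_nhds
    fun_prop
  rw [add_zero, one_mul] at h5
  exact ge_of_tendsto h5 (eventually_mem_nhdsWithin.mono hε)

theorem obar_of_closable {t s u : PBF H} (ht : t.Closable) (hs : s.Closable) (hu : u.Closable)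
    (hdef : OplusDef t s) (hsum : IsSum t s u) : Obar t s u := by
  refine ⟨⟨hdef, fun u' tr sr ur hu' htr hsr hur => ?_⟩, hsum⟩
  obtain rfl := isSum_unique hsum hu'
  have et := htr.toFun_eq ht.isRegularPart_self
  have es := hsr.toFun_eq hs.isRegularPart_self
  have eu := hur.toFun_eq hu.isRegularPart_self
  refine ⟨by rw [hur.2.1, htr.2.1, hsr.2.1, hsum.1], fun x y hx hy => ?_⟩
  rw [et, es, eu, hsum.2 x y (hur.2.1 ▸ hx) (hur.2.1 ▸ hy)]

end PBF
open scoped ComplexConjugate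

/-- The form `(x, y) ↦ ⟨S x, S y⟩ + ψ x * conj (ψ y)` on the dense subspace `D`. -/
def sqForm (D : Submodule ℂ H) (hD : Dense (D : Set H)) (S : D →ₗ[ℂ] H) (ψ : D →ₗ[ℂ] ℂ) :
    PBF H where
  dom := D
  dense' := hD
  toFun x y := by
    classical
    exact if h : x ∈ D ∧ y ∈ D then
      inner ℂ (S ⟨y, h.2⟩) (S ⟨x, h.1⟩) + ψ ⟨x, h.1⟩ * conj (ψ ⟨y, h.2⟩) else 0
  zero_off x y h := dif_neg (by rwa [not_and_or])
  add_left x y z hx hy hz := by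
    have e : (⟨x + y, D.add_mem hx hy⟩ : D) = ⟨x, hx⟩ + ⟨y, hy⟩ := rfl
    simp only [hx, hy, hz, D.add_mem hx hy, and_self, dite_true]
    rw [e, map_add, map_add, inner_add_right]
    ring
  smul_left c x y hx hy := by
    have e : (⟨c • x, D.smul_mem c hx⟩ : D) = c • ⟨x, hx⟩ := rfl
    simp only [hx, hy, D.smul_mem c hx, and_self, dite_true]
    rw [e, map_smul, map_smul, inner_smul_right, smul_eq_mul]
    ring
  add_right x y z hx hy hz := by
    have e : (⟨y + z, D.add_mem hy hz⟩ : D) = ⟨y, hy⟩ + ⟨z, hz⟩ := rfl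
    simp only [hx, hy, hz, D.add_mem hy hz, and_self, dite_true]
    rw [e, map_add, map_add, inner_add_left, map_add]
    ring
  smul_right c x y hx hy := by
    have e : (⟨c • y, D.smul_mem c hy⟩ : D) = c • ⟨y, hy⟩ := rfl
    simp only [hx, hy, D.smul_mem c hy, and_self, dite_true]
    rw [e, map_smul, map_smul, inner_smul_left, smul_eq_mul, map_mul]
    ring
  re_nonneg x hx := by
    simp only [hx, and_self, dite_true, inner_self_eq_norm_sq_to_K, Complex.mul_conj,
      Complex.add_re, Complex.ofReal_re]
    norm_cast
    exact add_nonneg (sq_nonneg _) (Complex.normSq_nonneg _)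
  im_zero x hx := by
    simp only [hx, and_self, dite_true, Complex.mul_conj, Complex.add_im, Complex.ofReal_im,
      add_zero]
    exact inner_self_im (𝕜 := ℂ) _

theorem sqForm_apply {D : Submodule ℂ H} (hD : Dense (D : Set H)) (S : D →ₗ[ℂ] H)
    (ψ : D →ₗ[ℂ] ℂ) (x y : D) :
    (sqForm D hD S ψ).toFun x y = inner ℂ (S y) (S x) + ψ x * conj (ψ y) :=
  dif_pos ⟨x.2, y.2⟩

theorem sqForm_diag_re {D : Submodule ℂ H} (hD : Dense (D : Set H)) (S : D →ₗ[ℂ] H)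
    (ψ : D →ₗ[ℂ] ℂ) (x : D) :
    ((sqForm D hD S ψ).toFun x x).re = ‖S x‖ ^ 2 + ‖ψ x‖ ^ 2 := by
  rw [sqForm_apply, inner_self_eq_norm_sq_to_K, Complex.mul_conj, Complex.normSq_eq_norm_sq,
    Complex.add_re, Complex.ofReal_re]
  norm_cast

theorem sqForm_isClosedForm [CompleteSpace H] {T : H →ₗ.[ℂ] H} (hT : T.IsClosed)
    (hD : Dense (T.domain : Set H)) (u : H) :
    (sqForm T.domain hD T.toFun ((innerₛₗ ℂ u).comp T.toFun)).IsClosedForm := by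
  intro f hf hcauchy
  have hq : ∀ x : T.domain, (sqForm T.domain hD T.toFun ((innerₛₗ ℂ u).comp T.toFun)).q x =
      ‖T x‖ ^ 2 + ‖inner ℂ u (T x)‖ ^ 2 + ‖(x : H)‖ ^ 2 := fun x => by
    rw [PBF.q, sqForm_diag_re]
    rfl
  have hbound : ∀ ε : ℝ, 0 < ε → ∃ N, ∀ m ≥ N, ∀ n ≥ N,
      ‖T ⟨f m, hf m⟩ - T ⟨f n, hf n⟩‖ < ε ∧ ‖f m - f n‖ < ε := by
    intro ε hε
    obtain ⟨N, hN⟩ := hcauchy (ε ^ 2) (by positivity)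
    refine ⟨N, fun m hm n hn => ?_⟩
    have h := hN m hm n hn
    have e : f m - f n = ((⟨f m, hf m⟩ - ⟨f n, hf n⟩ : T.domain) : H) := rfl
    rw [e, hq, LinearPMap.map_sub] at h
    rw [e]
    constructor
    · refine lt_of_pow_lt_pow_left₀ 2 hε.le (lt_of_le_of_lt ?_ h)
      rw [add_assoc]
      exact le_add_of_nonneg_right (by positivity)
    · refine lt_of_pow_lt_pow_left₀ 2 hε.le (lt_of_le_of_lt ?_ h)
      exact le_add_of_nonneg_left (by positivity)
  have hf1 : CauchySeq f := Metric.cauchySeq_iff.2 fun ε hε => by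
    obtain ⟨N, hN⟩ := hbound ε hε
    exact ⟨N, fun m hm n hn => by rw [dist_eq_norm]; exact (hN m hm n hn).2⟩
  have hf2 : CauchySeq fun n => T ⟨f n, hf n⟩ := Metric.cauchySeq_iff.2 fun ε hε => by
    obtain ⟨N, hN⟩ := hbound ε hε
    exact ⟨N, fun m hm n hn => by rw [dist_eq_norm]; exact (hN m hm n hn).1⟩
  obtain ⟨x, hx⟩ := cauchySeq_tendsto_of_complete hf1
  obtain ⟨y, hy⟩ := cauchySeq_tendsto_of_complete hf2
  have hmem : (x, y) ∈ T.graph :=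
    hT.mem_of_tendsto (hx.prodMk_nhds hy) (Eventually.of_forall fun n => T.mem_graph ⟨f n, hf n⟩)
  obtain ⟨x', hx', hy'⟩ := (LinearPMap.mem_graph_iff T).1 hmem
  simp only at hx' hy'
  subst hx' hy'
  refine ⟨x', x'.2, ?_⟩
  have e : ∀ n, f n - x' = ((⟨f n, hf n⟩ - x' : T.domain) : H) := fun n => rfl
  have h1 : Tendsto (fun n => T ⟨f n, hf n⟩ - T x') atTop (nhds 0) := by
    simpa using hy.sub_const (T x')
  have h2 : Tendsto (fun n => f n - x') atTop (nhds 0) := by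
    simpa using hx.sub_const (x' : H)
  have h3 : Tendsto (fun n => ‖T ⟨f n, hf n⟩ - T x'‖ ^ 2 +
      ‖inner ℂ u (T ⟨f n, hf n⟩ - T x')‖ ^ 2 + ‖f n - x'‖ ^ 2) atTop
      (nhds (‖(0 : H)‖ ^ 2 + ‖inner ℂ u (0 : H)‖ ^ 2 + ‖(0 : H)‖ ^ 2)) :=
    ((h1.norm.pow 2).add ((tendsto_const_nhds.inner h1).norm.pow 2)).add (h2.norm.pow 2)
  rw [inner_zero_right, norm_zero, norm_zero, zero_pow two_ne_zero, add_zero, add_zero] at h3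
  refine h3.congr fun n => ?_
  rw [e n, hq, LinearPMap.map_sub]

theorem sqForm_closable [CompleteSpace H] {D : Submodule ℂ H} (hD : Dense (D : Set H))
    {S : D →ₗ[ℂ] H} (hS : ∀ x y : D, inner ℂ (S x) (y : H) = inner ℂ (x : H) (S y))
    {ψ : D →ₗ[ℂ] ℂ} {u : H} (hu : ∀ x, ψ x = inner ℂ u (S x)) :
    (sqForm D hD S ψ).Closable := by
  let A : H →ₗ.[ℂ] H := ⟨D, S⟩
  have hA : A.IsFormalAdjoint A := hS
  have hle : A ≤ A.adjoint := hA.le_adjoint hD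
  have hdense : Dense (A.adjoint.domain : Set H) := hD.mono hle.1
  refine ⟨_, sqForm_isClosedForm (LinearPMap.adjoint_isClosed hD) hdense u, hle.1, ?_⟩
  intro x y hx hy
  have hx' : S ⟨x, hx⟩ = A.adjoint.toFun ⟨x, hle.1 hx⟩ :=
    hle.2 (x := ⟨x, hx⟩) (y := ⟨x, hle.1 hx⟩) rfl
  have hy' : S ⟨y, hy⟩ = A.adjoint.toFun ⟨y, hle.1 hy⟩ :=
    hle.2 (x := ⟨y, hy⟩) (y := ⟨y, hle.1 hy⟩) rfl
  rw [sqForm_apply hdense _ _ ⟨x, hle.1 hx⟩ ⟨y, hle.1 hy⟩, sqForm_apply hD S ψ ⟨x, hx⟩ ⟨y, hy⟩,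
    hu, hu, hx', hy']
  rfl

/-- The vectors with finitely many nonzero coordinates along `v`. -/
def finDom (v : ℕ → H) : Submodule ℂ H where
  carrier := {x | (Function.support fun k => inner ℂ (v k) x).Finite}
  zero_mem' := by simp
  add_mem' {x y} hx hy := by
    refine (hx.union hy).subset fun k hk => ?_
    by_contra h
    simp only [Set.mem_union, Function.mem_support, not_or, not_not] at h hk
    exact hk (by rw [inner_add_right, h.1, h.2, add_zero])
  smul_mem' c x hx := by
    refine hx.subset fun k hk h => hk ?_
    simp only at h ⊢
    rw [inner_smul_right, h, mul_zero]

/-- The coordinates along `v`. -/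
def coord (v : ℕ → H) : finDom v →ₗ[ℂ] ℕ →₀ ℂ where
  toFun x := Finsupp.ofSupportFinite (fun k => inner ℂ (v k) (x : H)) x.2
  map_add' x y := by
    ext k
    exact inner_add_right _ _ _
  map_smul' c x := by
    ext k
    exact inner_smul_right _ _ _

@[simp]
theorem coord_apply (v : ℕ → H) (x : finDom v) (k : ℕ) : coord v x k = inner ℂ (v k) (x : H) :=
  rfl

theorem mem_finDom {v : ℕ → H} (hv : Orthonormal ℂ v) (k : ℕ) : v k ∈ finDom v := by
  refine (Set.finite_singleton k).subset fun l hl => ?_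
  by_contra h
  exact hl (hv.2 h)

theorem coord_basis {v : ℕ → H} (hv : Orthonormal ℂ v) (k : ℕ) :
    coord v ⟨v k, mem_finDom hv k⟩ = Finsupp.single k 1 := by
  classical
  ext l
  rw [coord_apply, orthonormal_iff_ite.1 hv, Finsupp.single_apply]
  simp [eq_comm]

theorem dense_finDom [CompleteSpace H] {v : ℕ → H} (hv : Orthonormal ℂ v) :
    Dense (finDom v : Set H) := by
  rw [Submodule.dense_iff_topologicalClosure_eq_top, Submodule.topologicalClosure_eq_top_iff,
    Submodule.eq_bot_iff]
  intro z hz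
  rw [Submodule.mem_orthogonal] at hz
  have hmem : z ∈ finDom v := by
    refine Set.finite_empty.subset fun k hk => hk ?_
    exact hz _ (mem_finDom hv k)
  exact inner_self_eq_zero.1 (hz z hmem)

/-- The diagonal operator with eigenvalues `w` along `v`, vanishing orthogonally to `v`. -/
def diagOp (v : ℕ → H) (w : ℕ → ℝ) : finDom v →ₗ[ℂ] H :=
  (Finsupp.linearCombination ℂ fun k => (w k : ℂ) • v k).comp (coord v)

/-- The functional `x ↦ ∑ 2 ^ k ⟨x, v k⟩`. -/
def geomFunctional (v : ℕ → H) : finDom v →ₗ[ℂ] ℂ :=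
  (Finsupp.linearCombination ℂ fun k => (2 : ℂ) ^ k).comp (coord v)

theorem diagOp_apply (v : ℕ → H) (w : ℕ → ℝ) (x : finDom v) :
    diagOp v w x = ∑ k ∈ (coord v x).support, inner ℂ (v k) (x : H) • (w k : ℂ) • v k :=
  Finsupp.linearCombination_apply _ _

theorem geomFunctional_apply (v : ℕ → H) (x : finDom v) :
    geomFunctional v x = ∑ k ∈ (coord v x).support, inner ℂ (v k) (x : H) * 2 ^ k :=
  Finsupp.linearCombination_apply _ _

theorem diagOp_basis {v : ℕ → H} (hv : Orthonormal ℂ v) (w : ℕ → ℝ) (k : ℕ) :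
    diagOp v w ⟨v k, mem_finDom hv k⟩ = (w k : ℂ) • v k := by
  rw [diagOp, LinearMap.comp_apply, coord_basis hv, Finsupp.linearCombination_single, one_smul]

theorem geomFunctional_basis {v : ℕ → H} (hv : Orthonormal ℂ v) (k : ℕ) :
    geomFunctional v ⟨v k, mem_finDom hv k⟩ = 2 ^ k := by
  rw [geomFunctional, LinearMap.comp_apply, coord_basis hv, Finsupp.linearCombination_single,
    one_smul]

theorem inner_basis_diagOp {v : ℕ → H} (hv : Orthonormal ℂ v) (w : ℕ → ℝ) (k : ℕ)
    (x : finDom v) : inner ℂ (v k) (diagOp v w x) = w k * inner ℂ (v k) (x : H) := by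
  classical
  rw [diagOp_apply, inner_sum]
  simp only [inner_smul_right, orthonormal_iff_ite.1 hv, mul_ite, mul_one, mul_zero,
    Finset.sum_ite_eq, Finsupp.mem_support_iff, coord_apply]
  split_ifs with h
  · ring
  · rw [not_not.1 h, mul_zero]

theorem diagOp_symmetric (v : ℕ → H) (w : ℕ → ℝ) (x y : finDom v) :
    inner ℂ (diagOp v w x) (y : H) = inner ℂ (x : H) (diagOp v w y) := by
  classical
  have hx : diagOp v w x = ∑ k ∈ (coord v x).support ∪ (coord v y).support,
      inner ℂ (v k) (x : H) • (w k : ℂ) • v k := by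
    rw [diagOp_apply]
    refine Finset.sum_subset Finset.subset_union_left fun k _ hk => ?_
    rw [← coord_apply, Finsupp.notMem_support_iff.1 hk, zero_smul]
  have hy : diagOp v w y = ∑ k ∈ (coord v x).support ∪ (coord v y).support,
      inner ℂ (v k) (y : H) • (w k : ℂ) • v k := by
    rw [diagOp_apply]
    refine Finset.sum_subset Finset.subset_union_right fun k _ hk => ?_
    rw [← coord_apply, Finsupp.notMem_support_iff.1 hk, zero_smul]
  rw [hx, hy, sum_inner, inner_sum]
  refine Finset.sum_congr rfl fun k _ => ?_
  rw [inner_smul_left, inner_smul_left, inner_smul_right, inner_smul_right, inner_conj_symm,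
    Complex.conj_ofReal]
  ring

theorem inner_diagOp {v : ℕ → H} (hv : Orthonormal ℂ v) (w : ℕ → ℝ) (x y : finDom v) :
    inner ℂ (diagOp v w y) (diagOp v w x) = ∑ k ∈ (coord v x).support,
      ((w k ^ 2 : ℝ) : ℂ) * (inner ℂ (v k) (x : H) * conj (inner ℂ (v k) (y : H))) := by
  rw [diagOp_apply v w x, inner_sum]
  refine Finset.sum_congr rfl fun k _ => ?_
  rw [inner_smul_right, inner_smul_right, ← inner_conj_symm
    (diagOp v w y), inner_basis_diagOp hv, map_mul,
    Complex.conj_ofReal]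
  push_cast
  ring
/-- The quadratic form `∑ W k |⟨x, v k⟩|²`. -/
def energy (v : ℕ → H) (W : ℕ → ℝ) (x : finDom v) : ℝ :=
  ∑ k ∈ (coord v x).support, W k * ‖inner ℂ (v k) (x : H)‖ ^ 2

theorem energy_add (v : ℕ → H) (W W' : ℕ → ℝ) (x : finDom v) :
    energy v (W + W') x = energy v W x + energy v W' x := by
  simp only [energy, Pi.add_apply, add_mul, Finset.sum_add_distrib]

theorem energy_smul (v : ℕ → H) (c : ℝ) (W : ℕ → ℝ) (x : finDom v) :
    energy v (c • W) x = c * energy v W x := by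
  simp only [energy, Pi.smul_apply, smul_eq_mul, mul_assoc, Finset.mul_sum]

theorem energy_basis {v : ℕ → H} (hv : Orthonormal ℂ v) (W : ℕ → ℝ) (k : ℕ) :
    energy v W ⟨v k, mem_finDom hv k⟩ = W k := by
  classical
  rw [energy, coord_basis hv, Finsupp.support_single (hb := one_ne_zero), Finset.sum_singleton,
    inner_self_eq_norm_sq_to_K, hv.1 k]
  simp

theorem norm_sq_diagOp_sqrt {v : ℕ → H} (hv : Orthonormal ℂ v) {W : ℕ → ℝ} (hW : 0 ≤ W)
    (x : finDom v) : ‖diagOp v (fun k => √(W k)) x‖ ^ 2 = energy v W x := by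
  have h := inner_diagOp hv (fun k => √(W k)) x x
  rw [inner_self_eq_norm_sq_to_K] at h
  apply Complex.ofReal_injective
  rw [energy]
  push_cast
  refine h.trans (Finset.sum_congr rfl fun k _ => ?_)
  rw [Real.sq_sqrt (hW k), Complex.mul_conj, Complex.normSq_eq_norm_sq]
  push_cast
  rfl

theorem not_bounded_of_energy_le {v : ℕ → H} (hv : Orthonormal ℂ v) {W : ℕ → ℝ}
    (hunb : ∀ c, ∃ k, c < W k) {t : PBF H}
    (hdom : finDom v ≤ t.dom)
    (hle : ∀ x : finDom v, energy v W x ≤ (t.toFun x x).re) : ¬ t.Bounded := by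
  rintro ⟨c, hc⟩
  obtain ⟨k, hk⟩ := hunb c
  have h1 := hc _ (hdom (mem_finDom hv k))
  have h2 := hle ⟨v k, mem_finDom hv k⟩
  rw [energy_basis hv] at h2
  rw [hv.1 k] at h1
  linarith

section

variable [CompleteSpace H]

/-- The form `(x, y) ↦ ∑ W k x_k conj y_k + l φ(x) conj φ(y)` with `φ = geomFunctional v`. -/
def diagForm (v : ℕ → H) (hv : Orthonormal ℂ v) (W : ℕ → ℝ) (l : ℝ) : PBF H :=
  sqForm (finDom v) (dense_finDom hv) (diagOp v fun k => √(W k)) ((√l : ℂ) • geomFunctional v)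

theorem diagForm_apply {v : ℕ → H} (hv : Orthonormal ℂ v) {W : ℕ → ℝ} (hW : 0 ≤ W) {l : ℝ}
    (hl : 0 ≤ l) (x y : finDom v) :
    (diagForm v hv W l).toFun x y = ∑ k ∈ (coord v x).support,
      (W k : ℂ) * (inner ℂ (v k) (x : H) * conj (inner ℂ (v k) (y : H))) +
        l * (geomFunctional v x * conj (geomFunctional v y)) := by
  rw [diagForm, sqForm_apply, inner_diagOp hv]
  congr 1
  · refine Finset.sum_congr rfl fun k _ => ?_
    rw [Real.sq_sqrt (hW k)]
  · rw [LinearMap.smul_apply, LinearMap.smul_apply, smul_eq_mul, smul_eq_mul, map_mul,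
      Complex.conj_ofReal]
    have h : (l : ℂ) = √l * √l := by
      rw [← Complex.ofReal_mul, Real.mul_self_sqrt hl]
    rw [h]
    ring

theorem diagForm_diag {v : ℕ → H} (hv : Orthonormal ℂ v) {W : ℕ → ℝ} (hW : 0 ≤ W) {l : ℝ}
    (hl : 0 ≤ l) (x : finDom v) :
    ((diagForm v hv W l).toFun x x).re = energy v W x + l * ‖geomFunctional v x‖ ^ 2 := by
  rw [diagForm, sqForm_diag_re, norm_sq_diagOp_sqrt hv hW, LinearMap.smul_apply, smul_eq_mul,
    norm_mul, mul_pow, Complex.norm_real, Real.norm_eq_abs, sq_abs, Real.sq_sqrt hl]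

theorem diagForm_isSum {v : ℕ → H} (hv : Orthonormal ℂ v) {W W' : ℕ → ℝ} (hW : 0 ≤ W) (hW' : 0 ≤ W')
    {l l' : ℝ} (hl : 0 ≤ l)
    (hl' : 0 ≤ l') : PBF.IsSum (diagForm v hv W l) (diagForm v hv W' l')
      (diagForm v hv (W + W') (l + l')) := by
  refine ⟨(inf_idem _).symm, fun x y hx hy => ?_⟩
  have e := fun (W : ℕ → ℝ) (hW : 0 ≤ W) (l : ℝ) (hl : 0 ≤ l) =>
    diagForm_apply hv hW hl ⟨x, hx⟩ ⟨y, hy⟩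
  simp only at e
  rw [e _ (add_nonneg hW hW') _ (add_nonneg hl hl'), e _ hW _ hl, e _ hW' _ hl']
  simp only [Pi.add_apply, Complex.ofReal_add, add_mul, Finset.sum_add_distrib]
  ring

theorem diagForm_closable_zero {v : ℕ → H} (hv : Orthonormal ℂ v) (W : ℕ → ℝ) :
    (diagForm v hv W 0).Closable :=
  sqForm_closable (u := 0) _ (diagOp_symmetric v _) fun x => by simp

theorem exists_inner_diagOp_eq_geomFunctional {v : ℕ → H} (hv : Orthonormal ℂ v) {W : ℕ → ℝ} {δ : ℝ}
    (hδ : 0 < δ)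
    (hW : ∀ k, δ * 16 ^ k ≤ W k) :
    ∃ u : H, ∀ x, geomFunctional v x = inner ℂ u (diagOp v (fun k => √(W k)) x) := by
  have hpos : ∀ k, 0 < √(W k) := fun k =>
    Real.sqrt_pos.2 (lt_of_lt_of_le (by positivity) (hW k))
  have hbound : ∀ k, 2 ^ k / √(W k) ≤ (√δ)⁻¹ * (1 / 2) ^ k := by
    intro k
    have h1 : √δ * 4 ^ k ≤ √(W k) := by
      refine Real.le_sqrt_of_sq_le (le_trans (le_of_eq ?_) (hW k))
      rw [mul_pow, Real.sq_sqrt hδ.le, ← pow_mul, mul_comm k 2, pow_mul]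
      norm_num
    have h2 : 0 < √δ := Real.sqrt_pos.2 hδ
    rw [div_le_iff₀ (hpos k)]
    calc (2 : ℝ) ^ k = (√δ)⁻¹ * (1 / 2) ^ k * (√δ * 4 ^ k) := by
          have : (4 : ℝ) ^ k = 2 ^ k * 2 ^ k := by rw [← mul_pow]; norm_num
          rw [this]
          field_simp
          rw [← mul_pow]
          norm_num
      _ ≤ _ := by gcongr
  have hsum : Summable fun k => ((2 ^ k / √(W k) : ℝ) : ℂ) • v k := by
    refine Summable.of_norm_bounded
      ((summable_geometric_of_lt_one (by norm_num) (by norm_num)).mul_left (√δ)⁻¹)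
      (fun k => ?_) (g := fun k => (√δ)⁻¹ * (1 / 2) ^ k)
    rw [norm_smul, hv.1 k, mul_one, Complex.norm_real, Real.norm_of_nonneg (by positivity)]
    exact hbound k
  refine ⟨∑' k, ((2 ^ k / √(W k) : ℝ) : ℂ) • v k, fun x => ?_⟩
  have hu : ∀ k, inner ℂ (∑' j, ((2 ^ j / √(W j) : ℝ) : ℂ) • v j) (v k) =
      ((2 ^ k / √(W k) : ℝ) : ℂ) := by
    classical
    intro k
    have h := hsum.hasSum.mapL (innerSL ℂ (v k))
    have h' : HasSum (fun j => innerSL ℂ (v k) (((2 ^ j / √(W j) : ℝ) : ℂ) • v j))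
        ((2 ^ k / √(W k) : ℝ) : ℂ) := by
      convert hasSum_ite_eq k ((2 ^ k / √(W k) : ℝ) : ℂ) using 2 with j
      rw [innerSL_apply_apply, inner_smul_right, orthonormal_iff_ite.1 hv]
      by_cases hj : j = k
      · simp [hj]
      · simp [hj, Ne.symm hj]
    have h2 := h.unique h'
    rw [innerSL_apply_apply] at h2
    rw [← inner_conj_symm, h2, Complex.conj_ofReal]
  rw [diagOp_apply, inner_sum, geomFunctional_apply]
  refine Finset.sum_congr rfl fun k _ => ?_
  rw [inner_smul_right, inner_smul_right, hu, ← Complex.ofReal_mul,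
    mul_div_cancel₀ _ (hpos k).ne']
  push_cast
  rfl

theorem diagForm_closable_one {v : ℕ → H} (hv : Orthonormal ℂ v) {W : ℕ → ℝ} {δ : ℝ} (hδ : 0 < δ)
    (hW : ∀ k, δ * 16 ^ k ≤ W k) :
    (diagForm v hv W 1).Closable := by
  obtain ⟨u, hu⟩ := exists_inner_diagOp_eq_geomFunctional hv hδ hW
  exact sqForm_closable (u := u) _ (diagOp_symmetric v _) fun x => by
    rw [← hu, Real.sqrt_one, Complex.ofReal_one, one_smul]

theorem isRegularPart_diagForm {v : ℕ → H} (hv : Orthonormal ℂ v) {W : ℕ → ℝ} (hW : 0 ≤ W)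
    {κ : ℕ → ℕ} (hκ : ∀ k, k ≤ κ k)
    (hWκ : ∀ k, W (κ k) = 0) {t : PBF H} (hdom : t.dom = finDom v)
    (hle : ∀ x : finDom v, energy v W x ≤ (t.toFun x x).re)
    (hle' : ∀ x : finDom v, (t.toFun x x).re ≤ energy v W x + ‖geomFunctional v x‖ ^ 2) :
    t.IsRegularPart (diagForm v hv W 0) := by
  have hdiag : ∀ x : finDom v, ((diagForm v hv W 0).toFun x x).re = energy v W x := fun x => by
    rw [diagForm_diag hv hW le_rfl, zero_mul, add_zero]
  refine PBF.isRegularPart_of_null_sequences (diagForm_closable_zero hv W) hdom.symm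
    (fun x hx => ?_) fun x hx => ?_
  · rw [hdom] at hx
    rw [hdiag ⟨x, hx⟩]
    exact hle ⟨x, hx⟩
  rw [hdom] at hx
  let z : ℕ → finDom v := fun k =>
    (geomFunctional v ⟨x, hx⟩ * (1 / 2) ^ κ k) • ⟨v (κ k), mem_finDom hv _⟩
  have hφ : ∀ k, geomFunctional v (z k) = geomFunctional v ⟨x, hx⟩ := fun k => by
    rw [map_smul, geomFunctional_basis hv, smul_eq_mul, mul_assoc, ← mul_pow]
    norm_num
  have hS : ∀ k, diagOp v (fun k => √(W k)) (z k) = 0 := fun k => by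
    rw [map_smul, diagOp_basis hv, hWκ, Real.sqrt_zero, Complex.ofReal_zero, zero_smul, smul_zero]
  refine ⟨fun k => z k, fun k => by rw [hdom]; exact (z k).2, ?_, fun k l => ?_, fun k => ?_⟩
  · have h1 : Tendsto (fun k => ‖geomFunctional v ⟨x, hx⟩‖ * (1 / 2 : ℝ) ^ k) atTop (nhds 0) := by
      simpa using (tendsto_pow_atTop_nhds_zero_of_lt_one (r := (1 / 2 : ℝ)) (by norm_num)
        (by norm_num)).const_mul ‖geomFunctional v ⟨x, hx⟩‖
    refine squeeze_zero_norm (fun k => ?_) h1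
    have e : ((z k : finDom v) : H) =
      (geomFunctional v ⟨x, hx⟩ * (1 / 2) ^ κ k) • v (κ k) := rfl
    rw [e, norm_smul, hv.1, mul_one, norm_mul, norm_pow]
    have h2 : ‖(1 / 2 : ℂ)‖ = 1 / 2 := by norm_num
    rw [h2]
    exact mul_le_mul_of_nonneg_left
      (pow_le_pow_of_le_one (by norm_num) (by norm_num) (hκ k)) (norm_nonneg _)
  · refine (hle' (z k - z l)).trans (le_of_eq ?_)
    rw [← norm_sq_diagOp_sqrt hv hW, map_sub, map_sub, hS, hS, hφ, hφ]
    simp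
  · refine (hle' (⟨x, hx⟩ - z k)).trans (le_of_eq ?_)
    rw [hdiag ⟨x, hx⟩, ← norm_sq_diagOp_sqrt hv hW, ← norm_sq_diagOp_sqrt hv hW, map_sub, map_sub,
      hS, hφ]
    simp

end
theorem leBar.le {s t : PBF H} (h : leBar s t) {x : H} (hx : x ∈ t.dom) :
    (s.toFun x x).re ≤ (t.toFun x x).re := by
  obtain ⟨r, -, -, hdom, hsum⟩ := h
  rw [hsum x x hx hx, Complex.add_re]
  exact le_add_of_nonneg_right (r.re_nonneg x (hdom ▸ hx : x ∈ s.dom ⊓ r.dom).2)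

theorem exists_orthonormal_nat [CompleteSpace H] (h_inf : ¬ FiniteDimensional ℂ H) :
    ∃ v : ℕ → H, Orthonormal ℂ v := by
  obtain ⟨w, b, hb⟩ := exists_hilbertBasis ℂ H
  have : Infinite w := by
    by_contra h
    rw [not_infinite_iff_finite] at h
    have := Fintype.ofFinite w
    exact h_inf b.toOrthonormalBasis.toBasis.finiteDimensional_of_finite
  exact ⟨_, b.orthonormal.comp _ (Infinite.natEmbedding w).injective⟩

/-- `16 ^ k` at even `k`, and `0` at odd `k`. -/
def evenWeight (k : ℕ) : ℝ := if Even k then 16 ^ k else 0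

/-- `16 ^ k` at odd `k`, and `0` at even `k`. -/
def oddWeight (k : ℕ) : ℝ := if Even k then 0 else 16 ^ k

theorem evenWeight_nonneg : 0 ≤ evenWeight := fun k => by
  rw [evenWeight]
  split_ifs <;> simp

theorem oddWeight_nonneg : 0 ≤ oddWeight := fun k => by
  rw [oddWeight]
  split_ifs <;> simp

theorem exists_lt_sixteen_pow (c : ℝ) : ∃ k : ℕ, ∀ l ≥ k, c < 16 ^ l := by
  obtain ⟨k, hk⟩ := pow_unbounded_of_one_lt c (by norm_num : (1 : ℝ) < 16)
  exact ⟨k, fun l hl => hk.trans_le (pow_le_pow_right₀ (by norm_num) hl)⟩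

theorem evenWeight_unbounded (c : ℝ) : ∃ k, c < evenWeight k := by
  obtain ⟨k, hk⟩ := exists_lt_sixteen_pow c
  refine ⟨2 * k, ?_⟩
  rw [evenWeight, if_pos (even_two_mul k)]
  exact hk _ (by lia)

theorem oddWeight_unbounded (c : ℝ) : ∃ k, c < oddWeight k := by
  obtain ⟨k, hk⟩ := exists_lt_sixteen_pow c
  refine ⟨2 * k + 1, ?_⟩
  rw [oddWeight, if_neg (by simp)]
  exact hk _ (by lia)

theorem le_weight_add {s t δ : ℝ} (hs : δ ≤ s) (ht : δ ≤ t) (k : ℕ) :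
    δ * 16 ^ k ≤ (s • evenWeight + t • oddWeight) k := by
  simp only [Pi.add_apply, Pi.smul_apply, smul_eq_mul, evenWeight, oddWeight]
  split_ifs
  · rw [mul_zero, add_zero]
    gcongr
  · rw [mul_zero, zero_add]
    gcongr

section

variable [CompleteSpace H]

/-- The form `s ∑_{even} 16 ^ k |x_k|² + t ∑_{odd} 16 ^ k |x_k|² + l |∑ 2 ^ k x_k|²`. -/
def parityForm (v : ℕ → H) (hv : Orthonormal ℂ v) (s t l : ℝ) : PBF H :=
  diagForm v hv (s • evenWeight + t • oddWeight) l

theorem parityWeight_nonneg {s t : ℝ} (hs : 0 ≤ s) (ht : 0 ≤ t) :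
    0 ≤ s • evenWeight + t • oddWeight :=
  add_nonneg (smul_nonneg hs evenWeight_nonneg) (smul_nonneg ht oddWeight_nonneg)

theorem parityForm_diag {v : ℕ → H} (hv : Orthonormal ℂ v) {s t l : ℝ} (hs : 0 ≤ s) (ht : 0 ≤ t)
    (hl : 0 ≤ l) (x : finDom v) :
    ((parityForm v hv s t l).toFun x x).re =
      s * energy v evenWeight x + t * energy v oddWeight x + l * ‖geomFunctional v x‖ ^ 2 := by
  rw [parityForm, diagForm_diag hv (parityWeight_nonneg hs ht) hl, energy_add, energy_smul,
    energy_smul]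

theorem parityForm_isSum {v : ℕ → H} (hv : Orthonormal ℂ v) {s t l s' t' l' : ℝ} (hs : 0 ≤ s)
    (ht : 0 ≤ t) (hl : 0 ≤ l) (hs' : 0 ≤ s') (ht' : 0 ≤ t') (hl' : 0 ≤ l') :
    PBF.IsSum (parityForm v hv s t l) (parityForm v hv s' t' l')
      (parityForm v hv (s + s') (t + t') (l + l')) := by
  have h := diagForm_isSum hv (parityWeight_nonneg hs ht) (parityWeight_nonneg hs' ht') hl hl'
  rwa [add_add_add_comm, ← add_smul, ← add_smul] at h

theorem parityForm_closable_zero {v : ℕ → H} (hv : Orthonormal ℂ v) (s t : ℝ) :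
    (parityForm v hv s t 0).Closable :=
  diagForm_closable_zero hv _

theorem parityForm_closable_one {v : ℕ → H} (hv : Orthonormal ℂ v) {s t : ℝ} (hs : 0 < s)
    (ht : 0 < t) : (parityForm v hv s t 1).Closable :=
  diagForm_closable_one hv (lt_min hs ht) (le_weight_add (min_le_left s t) (min_le_right s t))

theorem parityForm_inVf {v : ℕ → H} (hv : Orthonormal ℂ v) {s t l : ℝ} (hs : 0 ≤ s) (ht : 0 ≤ t)
    (hl : 0 ≤ l) (hst : 0 < s ∨ 0 < t) : (parityForm v hv s t l).InVf := by
  refine fun h => absurd h ?_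
  refine not_bounded_of_energy_le hv (W := s • evenWeight + t • oddWeight) (fun c => ?_)
    le_rfl fun x => ?_
  · simp only [Pi.add_apply, Pi.smul_apply, smul_eq_mul]
    rcases hst with h | h
    · obtain ⟨k, hk⟩ := evenWeight_unbounded (c / s)
      refine ⟨k, lt_add_of_lt_of_nonneg ?_ (mul_nonneg ht (oddWeight_nonneg k))⟩
      rwa [div_lt_iff₀' h] at hk
    · obtain ⟨k, hk⟩ := oddWeight_unbounded (c / t)
      refine ⟨k, lt_add_of_nonneg_of_lt (mul_nonneg hs (evenWeight_nonneg k)) ?_⟩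
      rwa [div_lt_iff₀' h] at hk
  · rw [parityForm_diag hv hs ht hl, energy_add, energy_smul, energy_smul]
    exact le_add_of_nonneg_right (by positivity)

theorem leBar_parityForm {v : ℕ → H} (hv : Orthonormal ℂ v) {s t l s' t' l' : ℝ} (hs : 0 ≤ s)
    (ht : 0 ≤ t) (hl : 0 ≤ l) (hs' : 0 ≤ s') (ht' : 0 ≤ t') (hl' : 0 ≤ l')
    (hst' : 0 < s' ∨ 0 < t') (h : (parityForm v hv s t l).Closable)
    (h' : (parityForm v hv s' t' l').Closable)
    (hsum : (parityForm v hv (s + s') (t + t') (l + l')).Closable) :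
    leBar (parityForm v hv s t l) (parityForm v hv (s + s') (t + t') (l + l')) :=
  ⟨parityForm v hv s' t' l', parityForm_inVf hv hs' ht' hl' hst',
    PBF.obar_of_closable h h' hsum (Or.inr (Or.inr rfl))
      (parityForm_isSum hv hs ht hl hs' ht' hl')⟩

/-- An element squeezed between the even form and the functional part is not below the sum. -/
theorem not_leBar_parityForm_of_squeeze {v : ℕ → H} (hv : Orthonormal ℂ v) {i : PBF H}
    (hdom : i.dom = finDom v)
    (hle : ∀ x : finDom v, energy v evenWeight x ≤ (i.toFun x x).re)
    (hle' : ∀ x : finDom v,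
      (i.toFun x x).re ≤ energy v evenWeight x + ‖geomFunctional v x‖ ^ 2) :
    ¬ leBar i (parityForm v hv 1 1 1) := by
  rintro ⟨r, hr, ⟨hdef, hreg⟩, hsum⟩
  have hsub : finDom v = i.dom ⊓ r.dom := hsum.1
  have hrle : finDom v ≤ r.dom := hsub.le.trans inf_le_right
  have hdiag : ∀ x : finDom v, (i.toFun x x).re + (r.toFun x x).re =
      energy v evenWeight x + energy v oddWeight x + ‖geomFunctional v x‖ ^ 2 := fun x => by
    rw [← Complex.add_re, ← hsum.2 x x x.2 x.2,
      parityForm_diag hv zero_le_one zero_le_one zero_le_one, one_mul, one_mul, one_mul]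
  have hr1 : ∀ x : finDom v, energy v oddWeight x ≤ (r.toFun x x).re := fun x => by
    linarith [hdiag x, hle' x]
  have hr2 : ∀ x : finDom v,
      (r.toFun x x).re ≤ energy v oddWeight x + ‖geomFunctional v x‖ ^ 2 := fun x => by
    linarith [hdiag x, hle x]
  have hib := not_bounded_of_energy_le hv evenWeight_unbounded hdom.ge hle
  have hrb := not_bounded_of_energy_le hv oddWeight_unbounded hrle hr1
  have hrdom : r.dom = finDom v := by
    rcases hdef with h | h | h
    · exact absurd h hib
    · exact absurd h hrb
    · rw [← h, hdom]
  have hi := isRegularPart_diagForm hv evenWeight_nonneg (κ := fun k => 2 * k + 1)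
    (fun k => by lia) (fun k => if_neg (by simp)) hdom hle hle'
  have hr' := isRegularPart_diagForm hv oddWeight_nonneg (κ := fun k => 2 * k)
    (fun k => by lia) (fun k => if_pos (by simp)) hrdom hr1 hr2
  have h := hreg _ _ _ _ hsum hi hr'
    (parityForm_closable_one hv one_pos one_pos).isRegularPart_self
  let x : finDom v := ⟨v 0, mem_finDom hv 0⟩
  have h1 := congrArg Complex.re (h.2 x x x.2 x.2)
  rw [Complex.add_re, parityForm_diag hv zero_le_one zero_le_one zero_le_one,
    diagForm_diag hv evenWeight_nonneg le_rfl, diagForm_diag hv oddWeight_nonneg le_rfl,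
    geomFunctional_basis hv] at h1
  norm_num at h1

end
/-- The generalized effect algebra `(𝓥_f(𝓗); ⊕̄, o)` is not monotone
Dedekind downwards σ-complete: there is a non-increasing sequence (w.r.t. the order induced
by `⊕̄`) in `𝓥_f(𝓗)` with no infimum. -/
theorem stmt_18 [CompleteSpace H] (h_inf : ¬ FiniteDimensional ℂ H) :
    ∃ f : ℕ → PBF H, (∀ n, (f n).InVf) ∧
      (∀ n, leBar (f (n + 1)) (f n)) ∧
      ¬ ∃ i : PBF H, i.InVf ∧ (∀ n, leBar i (f n)) ∧
        ∀ z : PBF H, z.InVf → (∀ n, leBar z (f n)) → leBar z i := by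
  obtain ⟨v, hv⟩ := exists_orthonormal_nat h_inf
  let δ : ℕ → ℝ := fun n => 1 / (n + 1)
  have hδ : ∀ n, 0 < δ n := fun n => Nat.one_div_pos_of_nat
  have hδ0 : Tendsto δ atTop (nhds 0) := tendsto_one_div_add_atTop_nhds_zero_nat
  have hf : ∀ n, (parityForm v hv 1 (δ n) 1).Closable := fun n =>
    parityForm_closable_one hv one_pos (hδ n)
  refine ⟨fun n => parityForm v hv 1 (δ n) 1, fun n =>
    parityForm_inVf hv zero_le_one (hδ n).le zero_le_one (Or.inl one_pos), fun n => ?_, ?_⟩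
  · have hlt : 0 < δ n - δ (n + 1) :=
      sub_pos.2 (Nat.one_div_lt_one_div (Nat.lt_succ_self n))
    have h := leBar_parityForm hv (s := 1) (t := δ (n + 1)) (l := 1) (s' := 0)
      (t' := δ n - δ (n + 1)) (l' := 0) zero_le_one (hδ _).le zero_le_one le_rfl hlt.le le_rfl
      (Or.inr hlt) (hf _) (parityForm_closable_zero hv _ _)
    simp only [add_zero, add_sub_cancel] at h
    exact h (hf n)
  rintro ⟨i, -, hlow, hgreatest⟩
  have hz : ∀ ε : ℝ, 0 < ε → ε < 1 → leBar (parityForm v hv (1 - ε) 0 0) i := fun ε hε hε1 => by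
    have hε' : 0 < 1 - ε := sub_pos.2 hε1
    refine hgreatest _ (parityForm_inVf hv hε'.le le_rfl le_rfl (Or.inl hε')) fun n => ?_
    have h := leBar_parityForm hv (s := 1 - ε) (t := 0) (l := 0) (s' := ε)
      (t' := δ n) (l' := 1) hε'.le le_rfl le_rfl hε.le (hδ n).le zero_le_one
      (Or.inl hε) (parityForm_closable_zero hv _ _) (parityForm_closable_one hv hε (hδ n))
    rw [sub_add_cancel, zero_add, zero_add] at h
    exact h (hf n)
  have hsub : finDom v ≤ i.dom := by
    obtain ⟨r, -, -, hsum⟩ := hlow 0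
    exact (show finDom v = i.dom ⊓ r.dom from hsum.1).le.trans inf_le_left
  have hdom : i.dom = finDom v := by
    refine le_antisymm ?_ hsub
    obtain ⟨r, -, -, hsum⟩ := hz (1 / 2) (by norm_num) (by norm_num)
    exact (show i.dom = finDom v ⊓ r.dom from hsum.1).le.trans inf_le_left
  refine not_leBar_parityForm_of_squeeze hv hdom (fun x => ?_) (fun x => ?_) ?_
  · have h : ∀ n, (1 - δ (n + 1)) * energy v evenWeight x ≤ (i.toFun x x).re := fun n => by
      have hlt : δ (n + 1) < 1 := by
        have := Nat.one_div_lt_one_div (α := ℝ) (Nat.succ_pos n)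
        simpa [δ] using this
      have h := (hz (δ (n + 1)) (hδ _) hlt).le (hsub x.2)
      rwa [parityForm_diag hv (sub_pos.2 hlt).le le_rfl le_rfl, zero_mul, zero_mul, add_zero,
        add_zero] at h
    have hlim := ((hδ0.comp (tendsto_add_atTop_nat 1)).const_sub 1).mul_const
      (energy v evenWeight x)
    rw [sub_zero, one_mul] at hlim
    exact le_of_tendsto' hlim h
  · have h : ∀ n, (i.toFun x x).re ≤ energy v evenWeight x + δ n * energy v oddWeight x +
        ‖geomFunctional v x‖ ^ 2 := fun n => by
      have h := (hlow n).le x.2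
      rwa [parityForm_diag hv zero_le_one (hδ n).le zero_le_one, one_mul, one_mul] at h
    have hlim := ((hδ0.mul_const (energy v oddWeight x)).const_add
      (energy v evenWeight x)).add_const (‖geomFunctional v x‖ ^ 2)
    rw [zero_mul, add_zero] at hlim
    exact ge_of_tendsto' hlim h
  · have h := hlow 0
    simpa [δ] using h
end
end

section
/- Let 𝓗 be an infinite-dimensional complex Hilbert space. Let {t_n}_{n∈ℕ} be a sequence of closed positive bilinear forms with t₁ ≼ t₂ ≼ ⋯ ≼ t₀ for some closed positive bilinear form t₀ ∈ 𝓒_f(𝓗). Define D(t) = {x ∈ ∩_n D(t_n) : sup_n t_n(x,x) < ∞} and t(x,x) = lim_{n→∞} t_n(x,x) for x ∈ D(t). Then t is a closed positive bilinear form with D(t₀) ⊆ D(t), and t is the least upper bound of {t_n}_{n∈ℕ} in (𝓒_f(𝓗), ≼); hence 𝓒_f(𝓗) ordered by ≼ is a monotone Dedekind upwards σ-complete poset. -/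
set_option autoImplicit false

noncomputable section

open Filter

variable {H : Type*}

variable [NormedAddCommGroup H] [InnerProductSpace ℂ H]

/-- The order `t ≼ s`: `D(s) ⊆ D(t)` and `t(x,x) ≤ s(x,x)` for all `x ∈ D(s)`. -/
def preceq {H : Type*} [NormedAddCommGroup H] [InnerProductSpace ℂ H]
    (t s : PBF H) : Prop :=
  s.dom ≤ t.dom ∧ ∀ x ∈ s.dom, (t.toFun x x).re ≤ (s.toFun x x).re

namespace PBF

theorem toFun_add_smul_self (t : PBF H) {x y : H} (hx : x ∈ t.dom) (hy : y ∈ t.dom) (c : ℂ) :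
    t.toFun (x + c • y) (x + c • y) = t.toFun x x + (starRingEnd ℂ) c * t.toFun x y
      + c * t.toFun y x + c * (starRingEnd ℂ) c * t.toFun y y := by
  have hc := t.dom.smul_mem c hy
  rw [t.add_left _ _ _ hx hc (t.dom.add_mem hx hc), t.add_right _ _ _ hx hx hc,
    t.add_right _ _ _ hc hx hc, t.smul_left _ _ _ hy hx, t.smul_left _ _ _ hy hc,
    t.smul_right _ _ _ hx hy, t.smul_right _ _ _ hy hy]
  ring

theorem toFun_polarization (t : PBF H) {x y : H} (hx : x ∈ t.dom) (hy : y ∈ t.dom) :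
    t.toFun x y = (t.toFun (x + (1 : ℂ) • y) (x + (1 : ℂ) • y)
      - t.toFun (x + (-1 : ℂ) • y) (x + (-1 : ℂ) • y)
      + Complex.I * t.toFun (x + Complex.I • y) (x + Complex.I • y)
      - Complex.I * t.toFun (x + (-Complex.I) • y) (x + (-Complex.I) • y)) / 4 := by
  simp only [t.toFun_add_smul_self hx hy, map_neg, map_one, Complex.conj_I]
  linear_combination (t.toFun x y / 2 - t.toFun y x / 2) * Complex.I_mul_I

theorem q_nonneg (t : PBF H) {x : H} (hx : x ∈ t.dom) : 0 ≤ t.q x :=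
  add_nonneg (t.re_nonneg x hx) (sq_nonneg _)

theorem re_add_le (t : PBF H) {x y : H} (hx : x ∈ t.dom) (hy : y ∈ t.dom) :
    (t.toFun (x + y) (x + y)).re ≤ 2 * (t.toFun x x).re + 2 * (t.toFun y y).re := by
  have h1 := congrArg Complex.re (t.toFun_add_smul_self hx hy 1)
  have h2 := congrArg Complex.re (t.toFun_add_smul_self hx hy (-1))
  have h3 := t.re_nonneg _ (t.dom.add_mem hx (t.dom.smul_mem (-1 : ℂ) hy))
  simp only [one_smul, map_one, map_neg, one_mul, mul_one, neg_mul, mul_neg, neg_neg,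
    Complex.add_re, Complex.neg_re] at h1 h2
  linarith

theorem re_smul_self (t : PBF H) {x : H} (hx : x ∈ t.dom) (c : ℂ) :
    (t.toFun (c • x) (c • x)).re = ‖c‖ ^ 2 * (t.toFun x x).re := by
  rw [t.smul_left _ _ _ hx (t.dom.smul_mem c hx), t.smul_right _ _ _ hx hx, ← mul_assoc,
    Complex.mul_conj, Complex.re_ofReal_mul, Complex.normSq_eq_norm_sq]

theorem q_add_le (t : PBF H) {x y : H} (hx : x ∈ t.dom) (hy : y ∈ t.dom) :
    t.q (x + y) ≤ 2 * t.q x + 2 * t.q y := by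
  have h1 := t.re_add_le hx hy
  have h2 := norm_add_le x y
  have h3 := norm_nonneg (x + y)
  unfold q
  nlinarith [sq_nonneg (‖x‖ - ‖y‖)]

theorem norm_sq_le_q (t : PBF H) {x : H} (hx : x ∈ t.dom) : ‖x‖ ^ 2 ≤ t.q x :=
  le_add_of_nonneg_left (t.re_nonneg x hx)

theorem ofReal_re_toFun_self (t : PBF H) {x : H} (hx : x ∈ t.dom) :
    ((t.toFun x x).re : ℂ) = t.toFun x x :=
  Complex.ext (by simp) (by simp [t.im_zero x hx])

theorem tendsto_of_tendsto_q (t : PBF H) {f : ℕ → H} {x : H} (hf : ∀ n, f n ∈ t.dom)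
    (hx : x ∈ t.dom) (h : Tendsto (fun n => t.q (f n - x)) atTop (nhds 0)) :
    Tendsto f atTop (nhds x) := by
  rw [tendsto_iff_norm_sub_tendsto_zero]
  have h1 : Tendsto (fun n => ‖f n - x‖ ^ 2) atTop (nhds 0) :=
    squeeze_zero (fun n => sq_nonneg _)
      (fun n => t.norm_sq_le_q (t.dom.sub_mem (hf n) hx)) h
  simpa using h1.sqrt

/-- A sequence that is Cauchy for `q` is Cauchy for the norm. -/
theorem cauchySeq_of_q (t : PBF H) {f : ℕ → H} (hf : ∀ n, f n ∈ t.dom)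
    (h : ∀ ε : ℝ, 0 < ε → ∃ N : ℕ, ∀ m ≥ N, ∀ n ≥ N, t.q (f m - f n) < ε) :
    CauchySeq f := by
  rw [Metric.cauchySeq_iff]
  intro ε hε
  obtain ⟨N, hN⟩ := h (ε ^ 2) (by positivity)
  refine ⟨N, fun m hm n hn => ?_⟩
  rw [dist_eq_norm]
  exact lt_of_pow_lt_pow_left₀ 2 hε.le
    ((t.norm_sq_le_q (t.dom.sub_mem (hf m) (hf n))).trans_lt (hN m hm n hn))

/-- The `q`-limit provided by closedness is the norm limit. -/
theorem IsClosedForm.mem_and_tendsto {t : PBF H} (ht : t.IsClosedForm) {f : ℕ → H} {x : H}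
    (hf : ∀ n, f n ∈ t.dom)
    (h : ∀ ε : ℝ, 0 < ε → ∃ N : ℕ, ∀ m ≥ N, ∀ n ≥ N, t.q (f m - f n) < ε)
    (hx : Tendsto f atTop (nhds x)) :
    x ∈ t.dom ∧ Tendsto (fun n => t.q (f n - x)) atTop (nhds 0) := by
  obtain ⟨y, hy, hlim⟩ := ht f hf h
  obtain rfl := tendsto_nhds_unique hx (t.tendsto_of_tendsto_q hf hy hlim)
  exact ⟨hy, hlim⟩

/-- A bounded closed form is everywhere defined. -/
theorem IsClosedForm.inVf {t : PBF H} (ht : t.IsClosedForm) : t.InVf := by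
  rintro ⟨c, hc⟩
  refine eq_top_iff.2 fun x _ => ?_
  obtain ⟨f, hf, hfx⟩ := mem_closure_iff_seq_limit.1 (t.dense' x)
  refine (ht.mem_and_tendsto hf (fun ε hε => ?_) hfx).1
  have hC : 0 < |c| + 1 := by positivity
  obtain ⟨N, hN⟩ := Metric.cauchySeq_iff.1 hfx.cauchySeq (Real.sqrt (ε / (|c| + 1)))
    (Real.sqrt_pos.2 (div_pos hε hC))
  refine ⟨N, fun m hm n hn => ?_⟩
  have h1 := hN m hm n hn
  rw [dist_eq_norm, Real.lt_sqrt (norm_nonneg _), lt_div_iff₀ hC] at h1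
  have h2 := hc _ (t.dom.sub_mem (hf m) (hf n))
  have h3 := mul_le_mul_of_nonneg_right (le_abs_self c) (sq_nonneg ‖f m - f n‖)
  unfold q
  linarith

/-- `t` is the pointwise limit of the sequence `f`, on the domain where the values of `f` are
bounded. -/
structure IsMonotoneLimit (f : ℕ → PBF H) (t : PBF H) : Prop where
  mem_dom : ∀ x : H, x ∈ t.dom ↔
    ((∀ n, x ∈ (f n).dom) ∧ BddAbove (Set.range fun n => ((f n).toFun x x).re))
  tendsto : ∀ x ∈ t.dom, Tendsto (fun n => (f n).toFun x x) atTop (nhds (t.toFun x x))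

namespace IsMonotoneLimit

variable {f : ℕ → PBF H} {t : PBF H}

theorem tendsto_re (h : IsMonotoneLimit f t) {x : H} (hx : x ∈ t.dom) :
    Tendsto (fun n => ((f n).toFun x x).re) atTop (nhds (t.toFun x x).re) :=
  (Complex.continuous_re.tendsto _).comp (h.tendsto x hx)

theorem preceq_limit (h : IsMonotoneLimit f t) (hmono : ∀ n, preceq (f n) (f (n + 1))) (n : ℕ) :
    preceq (f n) t := by
  refine ⟨fun x hx => ((h.mem_dom x).1 hx).1 n, fun x hx => ?_⟩
  exact Monotone.ge_of_tendsto
    (monotone_nat_of_le_succ fun k => (hmono k).2 x (((h.mem_dom x).1 hx).1 (k + 1)))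
    (h.tendsto_re hx) n

theorem limit_preceq (h : IsMonotoneLimit f t) {s : PBF H} (hs : ∀ n, preceq (f n) s) :
    preceq t s := by
  have hdom : s.dom ≤ t.dom := fun x hx => (h.mem_dom x).2
    ⟨fun n => (hs n).1 hx, ⟨(s.toFun x x).re, by rintro _ ⟨n, rfl⟩; exact (hs n).2 x hx⟩⟩
  exact ⟨hdom, fun x hx => le_of_tendsto' (h.tendsto_re (hdom hx)) fun n => (hs n).2 x hx⟩

theorem isClosedForm [CompleteSpace H] (h : IsMonotoneLimit f t)
    (hf : ∀ n, (f n).IsClosedForm) (hmono : ∀ n, preceq (f n) (f (n + 1))) :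
    t.IsClosedForm := by
  intro u hu hcau
  obtain ⟨x, hx⟩ := cauchySeq_tendsto_of_complete (t.cauchySeq_of_q hu hcau)
  have hq : ∀ n, ∀ y ∈ t.dom, (f n).q y ≤ t.q y := fun n y hy =>
    add_le_add_left ((h.preceq_limit hmono n).2 y hy) _
  have hun : ∀ n k, u k ∈ (f n).dom := fun n k => (h.preceq_limit hmono n).1 (hu k)
  have hlim : ∀ n, x ∈ (f n).dom ∧
      Tendsto (fun k => (f n).q (u k - x)) atTop (nhds 0) := fun n => by
    refine (hf n).mem_and_tendsto (hun n) (fun ε hε => ?_) hx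
    obtain ⟨N, hN⟩ := hcau ε hε
    exact ⟨N, fun m hm k hk => (hq n _ (t.dom.sub_mem (hu m) (hu k))).trans_lt (hN m hm k hk)⟩
  have key : ∀ ε : ℝ, 0 < ε → ∃ N : ℕ, ∀ m ≥ N, ∀ n, (f n).q (u m - x) ≤ 2 * ε := by
    intro ε hε
    obtain ⟨N, hN⟩ := hcau ε hε
    refine ⟨N, fun m hm n => ?_⟩
    have hl : Tendsto (fun k => 2 * ε + 2 * (f n).q (u k - x)) atTop (nhds (2 * ε)) := by
      simpa using ((hlim n).2.const_mul 2).const_add (2 * ε)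
    refine ge_of_tendsto hl ?_
    filter_upwards [eventually_ge_atTop N] with k hk
    have h1 := (f n).q_add_le ((f n).dom.sub_mem (hun n m) (hun n k))
      ((f n).dom.sub_mem (hun n k) (hlim n).1)
    rw [sub_add_sub_cancel] at h1
    have h2 := hq n _ (t.dom.sub_mem (hu m) (hu k))
    have h3 := hN m hm k hk
    linarith
  have hmem : ∀ ε : ℝ, 0 < ε → ∃ N : ℕ, ∀ m ≥ N, u m - x ∈ t.dom ∧ t.q (u m - x) ≤ 2 * ε := by
    intro ε hε
    obtain ⟨N, hN⟩ := key ε hε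
    refine ⟨N, fun m hm => ?_⟩
    have hd : u m - x ∈ t.dom := by
      refine (h.mem_dom _).2 ⟨fun n => (f n).dom.sub_mem (hun n m) (hlim n).1, 2 * ε, ?_⟩
      rintro _ ⟨n, rfl⟩
      exact (le_add_of_nonneg_right (sq_nonneg _)).trans (hN m hm n)
    exact ⟨hd, le_of_tendsto' ((h.tendsto_re hd).add_const _) fun n => hN m hm n⟩
  have hxt : x ∈ t.dom := by
    obtain ⟨N, hN⟩ := hmem 1 one_pos
    simpa using t.dom.sub_mem (hu N) (hN N le_rfl).1
  refine ⟨x, hxt, Metric.tendsto_atTop.2 fun ε hε => ?_⟩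
  obtain ⟨N, hN⟩ := hmem (ε / 4) (by positivity)
  refine ⟨N, fun m hm => ?_⟩
  obtain ⟨h1, h2⟩ := hN m hm
  rw [Real.dist_eq, sub_zero, abs_of_nonneg (t.q_nonneg h1)]
  linarith

end IsMonotoneLimit

/-- The subspace on which all forms of the sequence are defined and have bounded values. -/
def limitDom (f : ℕ → PBF H) : Submodule ℂ H where
  carrier := {x | (∀ n, x ∈ (f n).dom) ∧ BddAbove (Set.range fun n => ((f n).toFun x x).re)}
  zero_mem' := by
    refine ⟨fun n => (f n).dom.zero_mem, 0, ?_⟩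
    rintro _ ⟨n, rfl⟩
    have := (f n).re_smul_self (f n).dom.zero_mem 0
    simpa using this.le
  add_mem' := by
    rintro x y ⟨hx, a, ha⟩ ⟨hy, b, hb⟩
    refine ⟨fun n => (f n).dom.add_mem (hx n) (hy n), 2 * a + 2 * b, ?_⟩
    rintro _ ⟨n, rfl⟩
    have h1 := ha ⟨n, rfl⟩
    have h2 := hb ⟨n, rfl⟩
    have h3 := (f n).re_add_le (hx n) (hy n)
    dsimp only at h1 h2 h3 ⊢
    linarith
  smul_mem' := by
    rintro c x ⟨hx, a, ha⟩
    refine ⟨fun n => (f n).dom.smul_mem c (hx n), ‖c‖ ^ 2 * a, ?_⟩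
    rintro _ ⟨n, rfl⟩
    dsimp only
    rw [(f n).re_smul_self (hx n)]
    exact mul_le_mul_of_nonneg_left (ha ⟨n, rfl⟩) (sq_nonneg _)

theorem exists_tendsto_toFun {f : ℕ → PBF H} (hmono : ∀ n, preceq (f n) (f (n + 1))) {x y : H}
    (hx : x ∈ limitDom f) (hy : y ∈ limitDom f) :
    ∃ z, Tendsto (fun n => (f n).toFun x y) atTop (nhds z) := by
  have diag : ∀ w ∈ limitDom f, ∃ z, Tendsto (fun n => (f n).toFun w w) atTop (nhds z) := by
    rintro w ⟨hw, hb⟩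
    have h1 := tendsto_atTop_ciSup
      (monotone_nat_of_le_succ fun k => (hmono k).2 w (hw (k + 1))) hb
    refine ⟨_, ((Complex.continuous_ofReal.tendsto _).comp h1).congr fun n => ?_⟩
    exact (f n).ofReal_re_toFun_self (hw n)
  have hc : ∀ c : ℂ, x + c • y ∈ limitDom f := fun c =>
    (limitDom f).add_mem hx ((limitDom f).smul_mem c hy)
  obtain ⟨z₁, h₁⟩ := diag _ (hc 1)
  obtain ⟨z₂, h₂⟩ := diag _ (hc (-1))
  obtain ⟨z₃, h₃⟩ := diag _ (hc Complex.I)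
  obtain ⟨z₄, h₄⟩ := diag _ (hc (-Complex.I))
  exact ⟨_, ((((h₁.sub h₂).add (h₃.const_mul Complex.I)).sub
    (h₄.const_mul Complex.I)).div_const 4).congr fun n =>
      ((f n).toFun_polarization (hx.1 n) (hy.1 n)).symm⟩

theorem exists_isMonotoneLimit {f : ℕ → PBF H} (hmono : ∀ n, preceq (f n) (f (n + 1)))
    {b : PBF H} (hb : ∀ n, preceq (f n) b) : ∃ t : PBF H, IsMonotoneLimit f t := by
  have hex : ∀ x y : H, ∃ z, (x ∈ limitDom f → y ∈ limitDom f →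
      Tendsto (fun n => (f n).toFun x y) atTop (nhds z)) ∧
      (x ∉ limitDom f ∨ y ∉ limitDom f → z = 0) := by
    intro x y
    by_cases h : x ∈ limitDom f ∧ y ∈ limitDom f
    · obtain ⟨z, hz⟩ := exists_tendsto_toFun hmono h.1 h.2
      exact ⟨z, fun _ _ => hz, fun h' => by tauto⟩
    · exact ⟨0, fun h1 h2 => absurd ⟨h1, h2⟩ h, fun _ => rfl⟩
  choose g hg hg0 using hex
  have hadd : ∀ {x y}, x ∈ limitDom f → y ∈ limitDom f → x + y ∈ limitDom f :=
    (limitDom f).add_mem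
  have hsmul : ∀ (c : ℂ) {x}, x ∈ limitDom f → c • x ∈ limitDom f :=
    fun c _ h => (limitDom f).smul_mem c h
  refine ⟨{
    dom := limitDom f
    dense' := b.dense'.mono fun x hx => ⟨fun n => (hb n).1 hx, (b.toFun x x).re, by
      rintro _ ⟨n, rfl⟩
      exact (hb n).2 x hx⟩
    toFun := g
    zero_off := hg0
    add_left := fun x y z hx hy hz => tendsto_nhds_unique (hg _ _ (hadd hx hy) hz)
      (((hg x z hx hz).add (hg y z hy hz)).congr fun n =>
        ((f n).add_left _ _ _ (hx.1 n) (hy.1 n) (hz.1 n)).symm)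
    smul_left := fun c x y hx hy => tendsto_nhds_unique (hg _ _ (hsmul c hx) hy)
      (((hg x y hx hy).const_mul c).congr fun n =>
        ((f n).smul_left _ _ _ (hx.1 n) (hy.1 n)).symm)
    add_right := fun x y z hx hy hz => tendsto_nhds_unique (hg _ _ hx (hadd hy hz))
      (((hg x y hx hy).add (hg x z hx hz)).congr fun n =>
        ((f n).add_right _ _ _ (hx.1 n) (hy.1 n) (hz.1 n)).symm)
    smul_right := fun c x y hx hy => tendsto_nhds_unique (hg _ _ hx (hsmul c hy))
      (((hg x y hx hy).const_mul _).congr fun n =>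
        ((f n).smul_right _ _ _ (hx.1 n) (hy.1 n)).symm)
    re_nonneg := fun x hx => ge_of_tendsto'
      ((Complex.continuous_re.tendsto _).comp (hg x x hx hx))
      fun n => (f n).re_nonneg x (hx.1 n)
    im_zero := fun x hx => tendsto_nhds_unique
      ((Complex.continuous_im.tendsto _).comp (hg x x hx hx))
      (tendsto_const_nhds.congr fun n => ((f n).im_zero x (hx.1 n)).symm) },
    ⟨fun x => Iff.rfl, fun x hx => hg x x hx hx⟩⟩

end PBF

/-- Let `{tₙ}` be a sequence of closed positive bilinear forms with
`t₁ ≼ t₂ ≼ ⋯ ≼ t₀` for some `t₀ ∈ 𝓒_f(𝓗)`.  Let `t` be given by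
`D(t) = {x ∈ ∩ₙ D(tₙ) : supₙ tₙ(x,x) < ∞}` and `t(x,x) = limₙ tₙ(x,x)`.  Then `t` is a
closed positive bilinear form, `D(t₀) ⊆ D(t)`, and `t` is the least upper bound of `{tₙ}`
in `(𝓒_f(𝓗), ≼)`; hence `𝓒_f(𝓗)` ordered by `≼` is a monotone Dedekind upwards
σ-complete poset. -/
theorem stmt_19 [CompleteSpace H] (h_inf : ¬ FiniteDimensional ℂ H)
    (tn : ℕ → PBF H) (t0 : PBF H)
    (htn : ∀ n, (tn n).InVf ∧ (tn n).IsClosedForm)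
    (ht0 : t0.InVf ∧ t0.IsClosedForm)
    (hmono : ∀ n, preceq (tn n) (tn (n + 1)))
    (hbdd : ∀ n, preceq (tn n) t0)
    (t : PBF H)
    (ht_dom : ∀ x : H, x ∈ t.dom ↔
      ((∀ n, x ∈ (tn n).dom) ∧ BddAbove (Set.range fun n => ((tn n).toFun x x).re)))
    (ht_val : ∀ x ∈ t.dom, Filter.Tendsto (fun n => (tn n).toFun x x)
      Filter.atTop (nhds (t.toFun x x))) :
    t.IsClosedForm ∧ t.InVf ∧ t0.dom ≤ t.dom ∧
    -- `t` is an upper bound of `{tₙ}` w.r.t. `≼`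
    (∀ n, preceq (tn n) t) ∧
    -- and the least one among closed forms
    (∀ s : PBF H, s.InVf → s.IsClosedForm → (∀ n, preceq (tn n) s) → preceq t s) ∧
    -- hence `(𝓒_f(𝓗), ≼)` is a monotone Dedekind upwards σ-complete poset
    (∀ f : ℕ → PBF H, (∀ n, (f n).InVf ∧ (f n).IsClosedForm) →
      (∀ n, preceq (f n) (f (n + 1))) →
      (∃ b : PBF H, b.InVf ∧ b.IsClosedForm ∧ ∀ n, preceq (f n) b) →
      ∃ s : PBF H, s.InVf ∧ s.IsClosedForm ∧ (∀ n, preceq (f n) s) ∧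
        ∀ z : PBF H, z.InVf → z.IsClosedForm → (∀ n, preceq (f n) z) → preceq s z) := by
  have h : PBF.IsMonotoneLimit tn t := ⟨ht_dom, ht_val⟩
  have hcl := h.isClosedForm (fun n => (htn n).2) hmono
  refine ⟨hcl, hcl.inVf, (h.limit_preceq hbdd).1, h.preceq_limit hmono,
    fun s _ _ hs => h.limit_preceq hs, fun f hf hfmono ⟨b, _, _, hb⟩ => ?_⟩
  obtain ⟨s, hs⟩ := PBF.exists_isMonotoneLimit hfmono hb
  have hscl := hs.isClosedForm (fun n => (hf n).2) hfmono
  exact ⟨s, hscl.inVf, hscl, hs.preceq_limit hfmono, fun z _ _ hz => hs.limit_preceq hz⟩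
end
end
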